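/- Assume k is algebraically closed and fix the basis f̄₁, …, f̄_c of V. Fix d with 1 ≤ d ≤ c. For every homogeneous ideal 𝔞 of k[y₁, …, y_c] there exists a finitely generated R-module M such that for every ideal J ⊆ I generated by a Q-regular sequence g₁, …, g_d whose images ḡ₁, …, ḡ_d in V are k-linearly independent: Ext^i_{Q/J}(M,k) ≠ 0 for infinitely many i if and only if there exists a nonzero point (a₁, …, a_c) ∈ k^c at which every polynomial in 𝔞 vanishes and such that a₁f̄₁ + ⋯ + a_cf̄_c lies in the k-span of ḡ₁, …, ḡ_d. (Equivalently, a closed subset Y of G_d(V) is realized as V_R^d(M,N) for a pair of finitely generated R-modules if and only if Y = π(Γ(Z)) for a closed subset Z of G₁(V).) -/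

import Mathlib

open CategoryTheory IsLocalRing

/-- A local ring is regular if its maximal ideal can be generated by a regular sequence. -/
def IsRegularLocal (Q : Type) [CommRing Q] [IsLocalRing Q] : Prop :=
  ∃ rs : List Q, RingTheory.Sequence.IsRegular Q rs ∧
    Ideal.span {x | x ∈ rs} = maximalIdeal Q

theorem Module.IsTorsionBySet.mono' {Q M : Type} [CommRing Q] [AddCommGroup M] [Module Q M]
    {J I : Ideal Q} (h : Module.IsTorsionBySet Q M (I : Set Q)) (hJI : J ≤ I) :
    Module.IsTorsionBySet Q M (J : Set Q) := fun x a => @h x ⟨a.1, hJI a.2⟩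

/-- The `Q ⧸ J`-module structure on a module annihilated by `I ⊇ J`. -/
def modOver {Q : Type} [CommRing Q] {I : Ideal Q} (J : Ideal Q) (hJI : J ≤ I)
    (M : Type) [AddCommGroup M] [Module Q M]
    (hM : Module.IsTorsionBySet Q M (I : Set Q)) : Module (Q ⧸ J) M :=
  (hM.mono' hJI).module

theorem quot_isTorsionBySet (Q : Type) [CommRing Q] (J : Ideal Q) :
    Module.IsTorsionBySet Q (Q ⧸ J) (J : Set Q) := fun x a => by
  induction x using Quotient.inductionOn with
  | h q =>
    show ((a : Q) • Submodule.Quotient.mk q : Q ⧸ J) = 0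
    rw [← Submodule.Quotient.mk_smul, Submodule.Quotient.mk_eq_zero, smul_eq_mul]
    exact Ideal.mul_mem_right q J a.2

/-- The residue field `k = Q/𝔪` as a module over `Q ⧸ J` for any `J ≤ 𝔪`. -/
def kMod {Q : Type} [CommRing Q] [IsLocalRing Q] (J : Ideal Q) (hJm : J ≤ maximalIdeal Q) :
    Module (Q ⧸ J) (Q ⧸ maximalIdeal Q) :=
  modOver J hJm (Q ⧸ maximalIdeal Q) (quot_isTorsionBySet Q (maximalIdeal Q))

/-- `Ext^i_A(M, N)`, as a module over `A`, for explicitly given module structures. -/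
noncomputable def extMod (A : Type) [CommRing A] (M N : Type) [AddCommGroup M] [AddCommGroup N]
    (mM : Module A M) (mN : Module A N) (i : ℕ) : ModuleCat A :=
  ((Ext A (ModuleCat A) i).obj (Opposite.op (@ModuleCat.of A _ M _ mM))).obj
    (@ModuleCat.of A _ N _ mN)

/-- `Ext^i_A(M, N) ≠ 0` for infinitely many `i`. -/
def extInf (A : Type) [CommRing A] (M N : Type) [AddCommGroup M] [AddCommGroup N]
    (mM : Module A M) (mN : Module A N) : Prop :=
  ∀ n : ℕ, ∃ i, n ≤ i ∧ Nontrivial (extMod A M N mM mN i)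

/-- `Ext^i_A(M, N) = 0` for all `i ≫ 0`. -/
def extVan (A : Type) [CommRing A] (M N : Type) [AddCommGroup M] [AddCommGroup N]
    (mM : Module A M) (mN : Module A N) : Prop :=
  ∃ n₀ : ℕ, ∀ i, n₀ ≤ i → Subsingleton (extMod A M N mM mN i)

/-- The images in `V = I/𝔫I` of the elements `g i` of `I` are `k`-linearly independent. -/
def LinIndepInV (Q : Type) [CommRing Q] [IsLocalRing Q] (I : Ideal Q)
    {d : ℕ} (g : Fin d → Q) : Prop :=
  (∀ i, g i ∈ I) ∧
    ∀ a : Fin d → Q, (∑ i, a i * g i) ∈ maximalIdeal Q * I → ∀ i, a i ∈ maximalIdeal Q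

/-- The depth of a module over a local ring: the supremum of the lengths of
regular sequences on the module consisting of elements of the maximal ideal. -/
noncomputable def localDepth (Q : Type) [CommRing Q] [IsLocalRing Q]
    (M : Type) [AddCommGroup M] [Module Q M] : ℕ :=
  sSup {n | ∃ rs : List Q, rs.length = n ∧ (∀ r ∈ rs, r ∈ maximalIdeal Q) ∧
    RingTheory.Sequence.IsRegular M rs}

section HSpart1
namespace HS
open MvPolynomial

/-- graded module with a curved differential -/
structure GC (Q : Type) [CommRing Q] (c : ℕ) where
  E : Type
  [acg : AddCommGroup E]
  [mQ : Module Q E]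
  [mS : Module (MvPolynomial (Fin c) Q) E]
  [tow : IsScalarTower Q (MvPolynomial (Fin c) Q) E]
  δ : E →ₗ[MvPolynomial (Fin c) Q] E
  π : ℤ → E →ₗ[Q] E
  F : MvPolynomial (Fin c) Q
  π_idem : ∀ i x, π i (π i x) = π i x
  π_orth : ∀ i j x, i ≠ j → π i (π j x) = 0
  π_X : ∀ i t x, π (i + 2) ((X t : MvPolynomial (Fin c) Q) • x) = (X t : MvPolynomial (Fin c) Q) • π i x
  π_δ : ∀ i x, π (i + 1) (δ x) = δ (π i x)
  δδ : ∀ x, δ (δ x) = F • x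
  π_fin : ∀ x, ∃ b : ℤ, ∀ i, b ≤ i → π i x = 0
  fg : ∀ i, (LinearMap.range (π i)).FG
  fin : Module.Finite (MvPolynomial (Fin c) Q) E

attribute [instance] GC.acg GC.mQ GC.mS GC.tow GC.fin

variable {Q : Type} [CommRing Q] {c : ℕ}

theorem GC.δ_smul (X : GC Q c) (a : Q) (x : X.E) : X.δ (a • x) = a • X.δ x := by
  rw [← algebraMap_smul (MvPolynomial (Fin c) Q) a x, map_smul, algebraMap_smul]

/-- δ as a `Q`-linear map -/
noncomputable def GC.dQ (X : GC Q c) : X.E →ₗ[Q] X.E where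
  toFun := X.δ
  map_add' := map_add _
  map_smul' := X.δ_smul

/-- scalar multiplication by polynomial as a `Q`-linear map -/
noncomputable def GC.sQ (X : GC Q c) (b : MvPolynomial (Fin c) Q) : X.E →ₗ[Q] X.E where
  toFun x := b • x
  map_add' := smul_add b
  map_smul' a x := by
    rw [← algebraMap_smul (MvPolynomial (Fin c) Q) a x, smul_comm, algebraMap_smul]; rfl

@[simp] theorem GC.dQ_apply (X : GC Q c) (x : X.E) : X.dQ x = X.δ x := rfl
@[simp] theorem GC.sQ_apply (X : GC Q c) (b) (x : X.E) : X.sQ b x = b • x := rfl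

theorem GC.smul_comm' (X : GC Q c) (a : Q) (b : MvPolynomial (Fin c) Q) (x : X.E) :
    b • a • x = a • b • x := (X.sQ b).map_smul a x

theorem GC.CC_smul (X : GC Q c) (a : Q) (x : X.E) : (C a : MvPolynomial (Fin c) Q) • x = a • x :=
  algebraMap_smul (MvPolynomial (Fin c) Q) a x

theorem GC.π_monomial (X : GC Q c) (d : Fin c →₀ ℕ) : ∀ (a : Q) (i : ℤ) (x : X.E),
    X.π (i + 2 * (d.degree : ℕ)) (monomial d a • x) = monomial d a • X.π i x := by
  induction d using Finsupp.induction_linear with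
  | zero =>
    intro a i x
    have : (monomial 0 a : MvPolynomial (Fin c) Q) = C a := rfl
    simp [this, X.CC_smul]
  | single t k =>
    intro a
    induction k with
    | zero =>
      intro i x
      have : (monomial (Finsupp.single t 0) a : MvPolynomial (Fin c) Q) = C a := by simp
      simp [this, X.CC_smul]
    | succ k ih =>
      intro i x
      have : (monomial (Finsupp.single t (k+1)) a : MvPolynomial (Fin c) Q) =
        MvPolynomial.X t * monomial (Finsupp.single t k) a := by
        rw [MvPolynomial.X, monomial_mul, ← Finsupp.single_add, one_mul, add_comm 1 k]
      rw [this, mul_smul, mul_smul, ← ih, ← X.π_X]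
      congr 2
      simp; ring
  | add d e hd he =>
    intro a i x
    have : (monomial (d + e) a : MvPolynomial (Fin c) Q) = monomial d a * monomial e 1 := by
      rw [monomial_mul, mul_one]
    rw [this, mul_smul, mul_smul, ← he, ← hd]
    congr 2
    simp; ring

theorem GC.π_hom (X : GC Q c) {b : MvPolynomial (Fin c) Q} {m : ℕ} (hb : b.IsHomogeneous m)
    (i : ℤ) (x : X.E) : X.π (i + 2 * m) (b • x) = b • X.π i x := by
  conv_lhs => rw [b.as_sum]
  conv_rhs => rw [b.as_sum]
  rw [Finset.sum_smul, Finset.sum_smul, map_sum]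
  refine Finset.sum_congr rfl fun d hd => ?_
  have : d.degree = m := by
    have := hb (mem_support_iff.1 hd)
    rw [← this, Finsupp.degree_eq_weight_one]; rfl
  rw [← X.π_monomial, this]

/-- step data -/
structure SD (Q : Type) [CommRing Q] (c : ℕ) where
  a : Q
  b : MvPolynomial (Fin c) Q
  m : ℕ
  hb : b.IsHomogeneous m
  h : a = 0 ∨ m = 1

def SD.w (s : SD Q c) : ℤ := 2 * s.m - 1

/-- Koszul step -/
noncomputable def GC.step (X : GC Q c) (s : SD Q c) : GC Q c where
  E := X.E × X.E
  δ := LinearMap.prod (X.δ ∘ₗ LinearMap.fst _ _ _ + s.b • LinearMap.snd _ _ _)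
    ((C s.a : MvPolynomial (Fin c) Q) • LinearMap.fst _ _ _ - X.δ ∘ₗ LinearMap.snd _ _ _)
  π i := LinearMap.prodMap (X.π i) (X.π (i - s.w))
  F := X.F + C s.a * s.b
  π_idem i x := by ext <;> simp [X.π_idem]
  π_orth i j x h := by
    ext
    · simp [X.π_orth _ _ _ h]
    · have : i - s.w ≠ j - s.w := by omega
      simp [X.π_orth _ _ _ this]
  π_X i t x := by
    ext
    · simp [X.π_X]
    · have : i + 2 - s.w = (i - s.w) + 2 := by ring
      simp [X.π_X, this]
  π_δ i x := by
    ext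
    · have : i + 1 = (i - s.w) + 2 * s.m := by simp [SD.w]; ring
      simp only [LinearMap.prodMap_apply, LinearMap.prod_apply, Function.prod_apply, LinearMap.add_apply, LinearMap.comp_apply, LinearMap.fst_apply, LinearMap.snd_apply, LinearMap.smul_apply, LinearMap.sub_apply, map_add, X.π_δ]
      conv_lhs => rw [this]
      rw [X.π_hom s.hb]
    · have h1 : i + 1 - s.w = (i - s.w) + 1 := by ring
      have : X.π (i + 1 - s.w) (s.a • x.1) = s.a • X.π i x.1 := by
        rcases s.h with h | h
        · simp [h]
        · simp [SD.w, h]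
      simp [X.CC_smul, this]
      rw [h1, X.π_δ]
  δδ x := by
    ext
    · simp [X.δδ, X.CC_smul, X.δ_smul, smul_sub, add_smul, mul_smul, X.smul_comm']
    · simp [X.δδ, X.CC_smul, X.δ_smul, smul_sub, add_smul, mul_smul, X.smul_comm', smul_add]
      abel
  π_fin x := by
    obtain ⟨b1, h1⟩ := X.π_fin x.1
    obtain ⟨b2, h2⟩ := X.π_fin x.2
    refine ⟨max b1 (b2 + s.w), fun i hi => ?_⟩
    ext
    · simpa using h1 i (by omega)
    · simpa using h2 (i - s.w) (by omega)
  fg i := by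
    rw [LinearMap.range_prodMap]
    exact (X.fg i).prod (X.fg _)
  fin := inferInstance

theorem GC.step_δ (X : GC Q c) (s : SD Q c) (x : (X.step s).E) :
    (X.step s).δ x = (X.δ x.1 + s.b • x.2, s.a • x.1 - X.δ x.2) := by
  rw [← X.CC_smul]; rfl

theorem GC.step_π (X : GC Q c) (s : SD Q c) (i : ℤ) (x : (X.step s).E) :
    (X.step s).π i x = (X.π i x.1, X.π (i - s.w) x.2) := rfl

noncomputable def GC.steps (X : GC Q c) (l : List (SD Q c)) : GC Q c := l.foldr (fun s Y => Y.step s) X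

theorem GC.π_Xlow (X : GC Q c) (b : MvPolynomial (Fin c) Q) (n : ℤ) :
    ∀ x : X.E, (∀ i < n, X.π i x = 0) → ∀ i < n, X.π i (b • x) = 0 := by
  induction b using MvPolynomial.induction_on with
  | C a => intro x h i hi; rw [X.CC_smul, map_smul, h i hi, smul_zero]
  | add p q hp hq => intro x h i hi; rw [add_smul, map_add, hp x h i hi, hq x h i hi, add_zero]
  | mul_X p t hp =>
    intro x h i hi
    rw [mul_smul]
    refine hp _ (fun j hj => ?_) i hi
    have := X.π_X (j - 2) t x
    rw [sub_add_cancel] at this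
    rw [this, h _ (by omega), smul_zero]

def GC.truncS (X : GC Q c) (n : ℤ) : Submodule (MvPolynomial (Fin c) Q) X.E where
  carrier := {x | ∀ i < n, X.π i x = 0}
  add_mem' := by
    intro x y hx hy i hi
    rw [map_add, hx i hi, hy i hi, add_zero]
  zero_mem' := by intro i _; simp
  smul_mem' b x hx := X.π_Xlow b n x hx

theorem GC.mem_truncS (X : GC Q c) (n : ℤ) (x : X.E) :
  x ∈ X.truncS n ↔ ∀ i < n, X.π i x = 0 := Iff.rfl

theorem GC.π_mem_truncS (X : GC Q c) (n i : ℤ) (x : X.E) (hx : x ∈ X.truncS n) :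
    X.π i x ∈ X.truncS n := by
  intro j hj
  by_cases h : j = i
  · subst h; rw [X.π_idem, hx j hj]
  · exact X.π_orth _ _ _ h

theorem GC.π_mem_truncS' (X : GC Q c) (n i : ℤ) (hi : n ≤ i) (x : X.E) :
    X.π i x ∈ X.truncS n := by
  intro j hj
  exact X.π_orth _ _ _ (by omega)

theorem GC.δ_mem_truncS (X : GC Q c) (n : ℤ) (x : X.E) (hx : x ∈ X.truncS n) :
    X.δ x ∈ X.truncS n := by
  intro j hj
  have := X.π_δ (j - 1) x
  rw [sub_add_cancel] at this
  rw [this, hx _ (by omega), map_zero]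

/-- truncation -/
noncomputable def GC.trunc [IsNoetherianRing Q] (X : GC Q c) (n : ℤ) : GC Q c where
  E := X.truncS n
  tow := ⟨fun a b x => Subtype.ext (smul_assoc a b x.1)⟩
  δ := X.δ.restrict (X.δ_mem_truncS n)
  π i := (X.π i).restrict (p := (X.truncS n).restrictScalars Q) (q := (X.truncS n).restrictScalars Q)
    (X.π_mem_truncS n i)
  F := X.F
  π_idem i x := by ext; exact X.π_idem _ _
  π_orth i j x h := by ext; exact X.π_orth _ _ _ h
  π_X i t x := by ext; exact X.π_X _ _ _
  π_δ i x := by ext; exact X.π_δ _ _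
  δδ x := by ext; exact X.δδ _
  π_fin x := by
    obtain ⟨b, h⟩ := X.π_fin x.1
    exact ⟨b, fun i hi => by ext; exact h i hi⟩
  fg i := by
    apply Submodule.fg_of_fg_map_injective ((X.truncS n).restrictScalars Q).subtype
      (Submodule.subtype_injective _)
    by_cases hi : n ≤ i
    · convert X.fg i using 1
      ext x
      constructor
      · rintro ⟨_, ⟨y, rfl⟩, rfl⟩
        exact ⟨y.1, rfl⟩
      · rintro ⟨y, rfl⟩
        refine ⟨⟨X.π i y, X.π_mem_truncS' n i hi y⟩, ⟨⟨X.π i y, X.π_mem_truncS' n i hi y⟩, ?_⟩, rfl⟩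
        ext; exact X.π_idem _ _
    · convert Submodule.fg_bot
      rw [eq_bot_iff]
      rintro _ ⟨_, ⟨y, rfl⟩, rfl⟩
      exact y.2 i (by omega)
  fin := by
    have : IsNoetherian (MvPolynomial (Fin c) Q) X.E := inferInstance
    exact inferInstance

theorem base_fg (i : ℤ) : (LinearMap.range (weightedHomogeneousComponent (R := Q) (fun _ : Fin c => (2:ℤ)) i)).FG := by
  have hfin : Set.Finite {d : Fin c →₀ ℕ | Finsupp.weight (fun _ : Fin c => (2:ℤ)) d = i} := by
    refine (Finsupp.finite_of_degree_le i.toNat).subset fun d hd => ?_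
    simp only [Set.mem_ofPred_eq] at hd ⊢
    have : Finsupp.weight (fun _ : Fin c => (2:ℤ)) d = 2 * (d.degree : ℕ) := by
      simp [Finsupp.weight_apply, Finsupp.sum, Finsupp.degree_apply, Finset.mul_sum, mul_comm]
    omega
  have : (Submodule.span Q ((fun d => (monomial d (1:Q) : MvPolynomial (Fin c) Q)) '' {d : Fin c →₀ ℕ | Finsupp.weight (fun _ : Fin c => (2:ℤ)) d = i})).FG :=
    Submodule.fg_span (hfin.image _)
  refine (congrArg Submodule.FG ?_).mpr this
  apply le_antisymm
  · rintro _ ⟨p, rfl⟩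
    rw [weightedHomogeneousComponent_apply]
    refine Submodule.sum_mem _ fun d hd => ?_
    have : (monomial d (coeff d p) : MvPolynomial (Fin c) Q) = coeff d p • monomial d 1 := by
      rw [smul_monomial, smul_eq_mul, mul_one]
    rw [this]
    exact Submodule.smul_mem _ _ (Submodule.subset_span ⟨d, (Finset.mem_filter.1 hd).2, rfl⟩)
  · rw [Submodule.span_le]
    rintro _ ⟨d, hd, rfl⟩
    refine ⟨monomial d 1, ?_⟩
    ext e
    rw [coeff_weightedHomogeneousComponent]
    simp only [coeff_monomial]
    grind

noncomputable def base (Q : Type) [CommRing Q] (c : ℕ) : GC Q c where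
  E := MvPolynomial (Fin c) Q
  δ := 0
  π i := weightedHomogeneousComponent (fun _ => (2:ℤ)) i
  F := 0
  π_idem i x := by ext d; simp only [coeff_weightedHomogeneousComponent]; grind
  π_orth i j x h := by ext d; simp only [coeff_weightedHomogeneousComponent, coeff_zero]; grind
  π_X i t x := by
    ext d; simp only [coeff_weightedHomogeneousComponent, smul_eq_mul, coeff_X_mul']
    by_cases hd : t ∈ d.support
    · simp only [hd, if_true]
      have : Finsupp.weight (fun _ : Fin c => (2:ℤ)) d = Finsupp.weight (fun _ : Fin c => (2:ℤ)) (d - Finsupp.single t 1) + 2 := by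
        conv_lhs => rw [← Finsupp.sub_add_single_one_cancel (Finsupp.mem_support_iff.1 hd)]
        rw [map_add]; simp [Finsupp.weight_single]
      rw [this]
      simp
    · simp [hd]
  π_δ i x := by simp
  δδ x := by simp
  π_fin x := by
    obtain ⟨b, hb⟩ := (x.support.image (Finsupp.weight (fun _ : Fin c => (2:ℤ)))).bddAbove
    refine ⟨b + 1, fun i hi => ?_⟩
    ext d
    rw [coeff_weightedHomogeneousComponent, coeff_zero]
    split_ifs with h
    · by_contra hd
      have := hb (Finset.mem_coe.2 (Finset.mem_image_of_mem _ (mem_support_iff.2 hd)))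
      omega
    · rfl
  fg := base_fg
  fin := inferInstance

end HS
end HSpart1

section HSpart2
namespace HS
open MvPolynomial

variable {Q : Type} [CommRing Q] {c : ℕ}

/-- homogeneous functionals killed by variables in Θ -/
def GC.TT (X : GC Q c) {N : Type} [AddCommGroup N] [Module Q N] (Θ : Set (Fin c)) (i : ℤ)
    (φ : X.E →ₗ[Q] N) : Prop :=
  (∀ x, φ (X.π i x) = φ x) ∧ ∀ r ∈ Θ, ∀ x, φ ((MvPolynomial.X r : MvPolynomial (Fin c) Q) • x) = 0

def GC.Lift (X : GC Q c) (Θ : Set (Fin c)) : Prop :=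
  ∀ (N N3 : Type) [AddCommGroup N] [Module Q N] [AddCommGroup N3] [Module Q N3] (r : N →ₗ[Q] N3),
    Function.Surjective r → ∀ (i : ℤ) (φ : X.E →ₗ[Q] N3), X.TT Θ i φ →
      ∃ ψ : X.E →ₗ[Q] N, X.TT Θ i ψ ∧ ∀ x, r (ψ x) = φ x

def GC.Surj (X : GC Q c) (Θ : Set (Fin c)) (t : Fin c) : Prop :=
  ∀ (N : Type) [AddCommGroup N] [Module Q N] (i : ℤ) (φ : X.E →ₗ[Q] N), X.TT Θ i φ →
      ∃ ψ : X.E →ₗ[Q] N, X.TT Θ (i + 2) ψ ∧ ∀ x, ψ ((MvPolynomial.X t : MvPolynomial (Fin c) Q) • x) = φ x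

def GC.Ex (X : GC Q c) (N : Type) [AddCommGroup N] [Module Q N] (Θ : Set (Fin c)) (i : ℤ) : Prop :=
  ∀ φ : X.E →ₗ[Q] N, X.TT Θ i φ → (∀ x, φ (X.δ x) = 0) →
    ∃ ψ : X.E →ₗ[Q] N, X.TT Θ (i + 1) ψ ∧ ∀ x, ψ (X.δ x) = φ x

section
variable {X : GC Q c} {N N3 : Type} [AddCommGroup N] [Module Q N] [AddCommGroup N3] [Module Q N3]

theorem GC.TT.sub {Θ : Set (Fin c)} {i : ℤ} {φ ψ : X.E →ₗ[Q] N} (h : X.TT Θ i φ) (h' : X.TT Θ i ψ) :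
    X.TT Θ i (φ - ψ) :=
  ⟨fun x => by simp [h.1, h'.1], fun r hr x => by simp [h.2 r hr, h'.2 r hr]⟩

theorem GC.TT.add {Θ : Set (Fin c)} {i : ℤ} {φ ψ : X.E →ₗ[Q] N} (h : X.TT Θ i φ) (h' : X.TT Θ i ψ) :
    X.TT Θ i (φ + ψ) :=
  ⟨fun x => by simp [h.1, h'.1], fun r hr x => by simp [h.2 r hr, h'.2 r hr]⟩

theorem GC.TT.D {Θ : Set (Fin c)} {i : ℤ} {φ : X.E →ₗ[Q] N} (h : X.TT Θ (i + 1) φ) :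
    X.TT Θ i (φ ∘ₗ X.dQ) :=
  ⟨fun x => by simp [← X.π_δ, h.1], fun r hr x => by simp [h.2 r hr]⟩

theorem GC.TT.D' {Θ : Set (Fin c)} {i : ℤ} {φ : X.E →ₗ[Q] N} (h : X.TT Θ i φ) :
    X.TT Θ (i - 1) (φ ∘ₗ X.dQ) := GC.TT.D (by rwa [sub_add_cancel])

theorem GC.TT.post {Θ : Set (Fin c)} {i : ℤ} {φ : X.E →ₗ[Q] N} (h : X.TT Θ i φ) (r : N →ₗ[Q] N3) :
    X.TT Θ i (r ∘ₗ φ) :=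
  ⟨fun x => by simp [h.1], fun t ht x => by simp [h.2 t ht]⟩

/-- division by a nonzerodivisor -/
theorem exists_div {E : Type} [AddCommGroup E] [Module Q E] (h : Q) (inj : ∀ z : N, h • z = 0 → z = 0)
    (α : E →ₗ[Q] N) (hα : ∀ x, ∃ z, α x = h • z) : ∃ β : E →ₗ[Q] N, ∀ x, α x = h • β x := by
  have inj' : ∀ z z' : N, h • z = h • z' → z = z' := fun z z' e =>
    sub_eq_zero.1 (inj _ (by rw [smul_sub, e, sub_self]))
  choose β hβ using hα
  refine ⟨⟨⟨β, fun x y => inj' _ _ ?_⟩, fun a x => inj' _ _ ?_⟩, hβ⟩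
  · rw [← hβ, smul_add, ← hβ, ← hβ, map_add]
  · rw [← hβ, RingHom.id_apply, smul_comm, ← hβ, map_smul]

theorem GC.TT.div {Θ : Set (Fin c)} {i : ℤ} {α β : X.E →ₗ[Q] N} (hα : X.TT Θ i α) (h : Q)
    (inj : ∀ z : N, h • z = 0 → z = 0) (e : ∀ x, α x = h • β x) : X.TT Θ i β := by
  have inj' : ∀ z z' : N, h • z = h • z' → z = z' := fun z z' e =>
    sub_eq_zero.1 (inj _ (by rw [smul_sub, e, sub_self]))
  refine ⟨fun x => inj' _ _ ?_, fun r hr x => inj _ ?_⟩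
  · rw [← e, ← e, hα.1]
  · rw [← e, hα.2 r hr]

variable (s : SD Q c)

noncomputable def GC.cop (φ1 φ2 : X.E →ₗ[Q] N) : (X.step s).E →ₗ[Q] N := LinearMap.coprod φ1 φ2
noncomputable def GC.inl : X.E →ₗ[Q] (X.step s).E := LinearMap.inl Q X.E X.E
noncomputable def GC.inr : X.E →ₗ[Q] (X.step s).E := LinearMap.inr Q X.E X.E

theorem GC.cop_apply (φ1 φ2 : X.E →ₗ[Q] N) (x : (X.step s).E) :
    GC.cop s φ1 φ2 x = φ1 x.1 + φ2 x.2 := rfl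
theorem GC.inl_apply (x : X.E) : GC.inl s x = ((x, 0) : X.E × X.E) := rfl
theorem GC.inr_apply (x : X.E) : GC.inr s x = ((0, x) : X.E × X.E) := rfl

theorem GC.eq_inl_add_inr (x : (X.step s).E) : x = GC.inl s x.1 + GC.inr s x.2 := by
  rw [GC.inl_apply, GC.inr_apply]
  exact Prod.ext (add_zero _).symm (zero_add _).symm

theorem GC.δ_inl (x : X.E) : (X.step s).δ (GC.inl s x) = GC.inl s (X.δ x) + s.a • GC.inr s x := by
  rw [GC.step_δ, GC.inl_apply, GC.inl_apply, GC.inr_apply]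
  refine Prod.ext ?_ ?_
  · change X.δ x + s.b • (0 : X.E) = X.δ x + s.a • (0 : X.E); simp
  · change s.a • x - X.δ 0 = 0 + s.a • x; simp

theorem GC.δ_inr (x : X.E) : (X.step s).δ (GC.inr s x) = GC.inl s (s.b • x) - GC.inr s (X.δ x) := by
  rw [GC.step_δ, GC.inl_apply, GC.inr_apply, GC.inr_apply]
  refine Prod.ext ?_ ?_
  · change X.δ 0 + s.b • x = s.b • x - 0; simp
  · change s.a • (0 : X.E) - X.δ x = 0 - X.δ x; simp

theorem GC.π_inl (i : ℤ) (x : X.E) : (X.step s).π i (GC.inl s x) = GC.inl s (X.π i x) := by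
  rw [GC.step_π, GC.inl_apply, GC.inl_apply]
  refine Prod.ext rfl ?_
  change X.π _ 0 = 0; simp

theorem GC.π_inr (i : ℤ) (x : X.E) : (X.step s).π i (GC.inr s x) = GC.inr s (X.π (i - s.w) x) := by
  rw [GC.step_π, GC.inr_apply, GC.inr_apply]
  refine Prod.ext ?_ rfl
  change X.π _ 0 = 0; simp

theorem GC.smul_inl (b : MvPolynomial (Fin c) Q) (x : X.E) : b • (GC.inl s x) = GC.inl s (b • x) := by
  rw [GC.inl_apply, GC.inl_apply]
  refine Prod.ext rfl ?_
  change b • (0 : X.E) = 0; simp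

theorem GC.smul_inr (b : MvPolynomial (Fin c) Q) (x : X.E) : b • (GC.inr s x) = GC.inr s (b • x) := by
  rw [GC.inr_apply, GC.inr_apply]
  refine Prod.ext ?_ rfl
  change b • (0 : X.E) = 0; simp

theorem GC.cop_inl (φ1 φ2 : X.E →ₗ[Q] N) (x : X.E) : GC.cop s φ1 φ2 (GC.inl s x) = φ1 x := by
  rw [GC.cop_apply, GC.inl_apply]; simp
theorem GC.cop_inr (φ1 φ2 : X.E →ₗ[Q] N) (x : X.E) : GC.cop s φ1 φ2 (GC.inr s x) = φ2 x := by
  rw [GC.cop_apply, GC.inr_apply]; simp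

theorem GC.hom_ext_step {φ ψ : (X.step s).E →ₗ[Q] N} (h1 : ∀ x, φ (GC.inl s x) = ψ (GC.inl s x))
    (h2 : ∀ x, φ (GC.inr s x) = ψ (GC.inr s x)) (x) : φ x = ψ x := by
  rw [GC.eq_inl_add_inr s x, map_add, map_add, h1, h2]

theorem GC.TT_step {Θ : Set (Fin c)} {i : ℤ} {φ : (X.step s).E →ₗ[Q] N} :
    (X.step s).TT Θ i φ ↔ X.TT Θ i (φ ∘ₗ GC.inl s) ∧ X.TT Θ (i - s.w) (φ ∘ₗ GC.inr s) := by
  constructor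
  · intro h
    refine ⟨⟨fun x => ?_, fun r hr x => ?_⟩, ⟨fun x => ?_, fun r hr x => ?_⟩⟩
    · simp [← GC.π_inl, h.1]
    · simp [← GC.smul_inl, h.2 r hr]
    · simp [← GC.π_inr, h.1]
    · simp [← GC.smul_inr, h.2 r hr]
  · rintro ⟨h1, h2⟩
    refine ⟨fun x => ?_, fun r hr x => ?_⟩
    · refine GC.hom_ext_step (φ := φ ∘ₗ (X.step s).π i) s (fun x => ?_) (fun x => ?_) x
      · rw [LinearMap.comp_apply, GC.π_inl]; exact h1.1 x
      · rw [LinearMap.comp_apply, GC.π_inr]; exact h2.1 x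
    · refine GC.hom_ext_step (φ := φ ∘ₗ (X.step s).sQ (MvPolynomial.X r)) (ψ := 0) s (fun x => ?_) (fun x => ?_) x
      · rw [LinearMap.comp_apply, GC.sQ_apply, GC.smul_inl]; exact h1.2 r hr x
      · rw [LinearMap.comp_apply, GC.sQ_apply, GC.smul_inr]; exact h2.2 r hr x

theorem GC.TT_cop {Θ : Set (Fin c)} {i : ℤ} {φ1 φ2 : X.E →ₗ[Q] N} (h1 : X.TT Θ i φ1)
    (h2 : X.TT Θ (i - s.w) φ2) : (X.step s).TT Θ i (GC.cop s φ1 φ2) := by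
  rw [GC.TT_step]
  constructor
  · convert h1; ext x; exact GC.cop_inl s _ _ x
  · convert h2; ext x; exact GC.cop_inr s _ _ x
end

theorem GC.Lift.step {X : GC Q c} {Θ} (h : X.Lift Θ) (s : SD Q c) : (X.step s).Lift Θ := by
  intro N N3 _ _ _ _ r hr i φ hφ
  obtain ⟨h1, h2⟩ := (GC.TT_step s).1 hφ
  obtain ⟨ψ1, t1, e1⟩ := h N N3 r hr _ _ h1
  obtain ⟨ψ2, t2, e2⟩ := h N N3 r hr _ _ h2
  refine ⟨GC.cop s ψ1 ψ2, GC.TT_cop s t1 t2, fun x => ?_⟩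
  refine GC.hom_ext_step (φ := r ∘ₗ GC.cop s ψ1 ψ2) s (fun x => ?_) (fun x => ?_) x
  · rw [LinearMap.comp_apply, GC.cop_inl, e1]; rfl
  · rw [LinearMap.comp_apply, GC.cop_inr, e2]; rfl

theorem GC.Surj.step {X : GC Q c} {Θ t} (h : X.Surj Θ t) (s : SD Q c) : (X.step s).Surj Θ t := by
  intro N _ _ i φ hφ
  obtain ⟨h1, h2⟩ := (GC.TT_step s).1 hφ
  obtain ⟨ψ1, t1, e1⟩ := h N _ _ h1
  obtain ⟨ψ2, t2, e2⟩ := h N _ _ h2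
  refine ⟨GC.cop s ψ1 ψ2, GC.TT_cop s t1 (by rwa [sub_add_eq_add_sub] at t2), fun x => ?_⟩
  refine GC.hom_ext_step (φ := GC.cop s ψ1 ψ2 ∘ₗ (X.step s).sQ (MvPolynomial.X t)) s (fun x => ?_) (fun x => ?_) x
  · rw [LinearMap.comp_apply, GC.sQ_apply, GC.smul_inl, GC.cop_inl, e1]; rfl
  · rw [LinearMap.comp_apply, GC.sQ_apply, GC.smul_inr, GC.cop_inr, e2]; rfl

/-- main step lemma -/
theorem GC.stepH (X : GC Q c) (s : SD Q c) (hm : s.m = 1) (Θ : Set (Fin c)) (hL : X.Lift Θ)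
    {N N3 : Type} [AddCommGroup N] [Module Q N] [AddCommGroup N3] [Module Q N3] (r : N →ₗ[Q] N3)
    (hr : Function.Surjective r) (ker : ∀ y, r y = 0 → ∃ z, y = s.a • z)
    (inj : ∀ z : N, s.a • z = 0 → z = 0)
    (hF : ∀ i (φ : (X.step s).E →ₗ[Q] N), (X.step s).TT Θ i φ → ∀ x, φ ((X.step s).F • x) = 0)
    (i : ℤ) (φ : (X.step s).E →ₗ[Q] N) (hφ : (X.step s).TT Θ i φ)
    (hc : ∀ x, φ ((X.step s).δ x) = 0)
    (hex : ∃ ψ : X.E →ₗ[Q] N3, X.TT Θ (i + 1) ψ ∧ ∀ x, ψ (X.δ x) = r (φ (GC.inl s x))) :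
    ∃ ψ : (X.step s).E →ₗ[Q] N, (X.step s).TT Θ (i + 1) ψ ∧ ∀ x, ψ ((X.step s).δ x) = φ x := by
  obtain ⟨ψ, hψ, eψ⟩ := hex
  obtain ⟨a3, h3, e3⟩ := hL N N3 r hr _ _ hψ
  obtain ⟨h1, h2⟩ := (GC.TT_step s).1 hφ
  have h4 := h1.sub h3.D
  obtain ⟨β, hβ⟩ := exists_div s.a inj (φ ∘ₗ GC.inl s - a3 ∘ₗ X.dQ) (fun x => ker _ (by
    simp [e3, eψ]))
  have hβT := h4.div s.a inj hβ
  have hw : i + 1 - s.w = i := by simp [SD.w, hm]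
  have hT : (X.step s).TT Θ (i + 1) (GC.cop s a3 β) := GC.TT_cop s h3 (by rwa [hw])
  refine ⟨_, hT, ?_⟩
  set χ : (X.step s).E →ₗ[Q] N := φ - GC.cop s a3 β ∘ₗ (X.step s).dQ with hχ
  have c1 : ∀ x, χ (GC.inl s x) = 0 := by
    intro x
    have := hβ x
    simp only [LinearMap.sub_apply, LinearMap.comp_apply, GC.dQ_apply] at this
    simp only [hχ, LinearMap.sub_apply, LinearMap.comp_apply, GC.dQ_apply, GC.δ_inl, map_add,
      GC.cop_inl, map_smul, GC.cop_inr, ← this]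
    abel
  have c2 : ∀ x, χ ((X.step s).δ x) = 0 := by
    intro x
    simp [hχ, hc, GC.δδ, hF _ _ hT]
  have c3 : ∀ x, χ (GC.inr s x) = 0 := by
    intro x
    have := c2 (GC.inl s x)
    rw [GC.δ_inl, map_add, c1, zero_add, map_smul] at this
    exact inj _ this
  intro x
  have := GC.hom_ext_step (φ := χ) (ψ := 0) s c1 c3 x
  simp only [hχ, LinearMap.sub_apply, LinearMap.comp_apply, GC.dQ_apply, LinearMap.zero_apply] at this
  exact (sub_eq_zero.1 this).symm

theorem GC.step_cycle (X : GC Q c) (s : SD Q c)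
    {N N3 : Type} [AddCommGroup N] [Module Q N] [AddCommGroup N3] [Module Q N3] (r : N →ₗ[Q] N3)
    (hr0 : ∀ z, r (s.a • z) = 0)
    (φ : (X.step s).E →ₗ[Q] N) 
    (hc : ∀ x, φ ((X.step s).δ x) = 0) (x : X.E) : r (φ (GC.inl s (X.δ x))) = 0 := by
  have := hc (GC.inl s x)
  rw [GC.δ_inl, map_add, map_smul] at this
  rw [eq_neg_of_add_eq_zero_left this, map_neg, hr0, neg_zero]

theorem GC.step_Ex (X : GC Q c) (s : SD Q c) (hm : s.m = 1) (Θ : Set (Fin c)) (hL : X.Lift Θ)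
    {N N3 : Type} [AddCommGroup N] [Module Q N] [AddCommGroup N3] [Module Q N3] (r : N →ₗ[Q] N3)
    (hr : Function.Surjective r) (ker : ∀ y, r y = 0 → ∃ z, y = s.a • z)
    (hr0 : ∀ z, r (s.a • z) = 0)
    (inj : ∀ z : N, s.a • z = 0 → z = 0)
    (hF : ∀ i (φ : (X.step s).E →ₗ[Q] N), (X.step s).TT Θ i φ → ∀ x, φ ((X.step s).F • x) = 0)
    (i : ℤ) (h : X.Ex N3 Θ i) : (X.step s).Ex N Θ i := by
  intro φ hφ hc
  refine X.stepH s hm Θ hL r hr ker inj hF i φ hφ hc ?_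
  exact h (r ∘ₗ φ ∘ₗ GC.inl s) (((GC.TT_step s).1 hφ).1.post r) (X.step_cycle s r hr0 φ hc)

theorem GC.step_Ex0 (X : GC Q c) (s : SD Q c) (ha : s.a = 0) (hm : 1 ≤ s.m)
    {N : Type} [AddCommGroup N] [Module Q N] (i0 : ℤ)
    (h : ∀ i, i0 < i → X.Ex N ∅ i) (i : ℤ) (hi : i0 + s.w < i) : (X.step s).Ex N ∅ i := by
  intro φ hφ hc
  obtain ⟨h1, h2⟩ := (GC.TT_step s).1 hφ
  have hw : 1 ≤ s.w := by simp [SD.w]; omega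
  have cl : ∀ x, φ (GC.inl s (X.δ x)) = 0 := fun x => by
    have := hc (GC.inl s x)
    rwa [GC.δ_inl, ha, zero_smul, add_zero] at this
  have cr : ∀ x, φ (GC.inl s (s.b • x)) = φ (GC.inr s (X.δ x)) := fun x => by
    have := hc (GC.inr s x)
    rw [GC.δ_inr, map_sub] at this
    exact sub_eq_zero.1 this
  obtain ⟨ψ1, t1, e1⟩ := h i (by omega) _ h1 cl
  have tb : X.TT (N := N) ∅ (i - s.w) (ψ1 ∘ₗ X.sQ s.b) := by
    refine ⟨fun x => ?_, fun r hr => absurd hr (Set.notMem_empty r)⟩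
    have := X.π_hom s.hb (i - s.w) x
    simp only [LinearMap.comp_apply, GC.sQ_apply]
    rw [← this, ← t1.1 (s.b • x)]
    congr 2
    simp [SD.w]; ring
  obtain ⟨ψ2, t2, e2⟩ := h (i - s.w) (by omega) _ (tb.sub h2) (fun x => by
    simp only [LinearMap.sub_apply, LinearMap.comp_apply, GC.sQ_apply]
    rw [← map_smul, e1, ← cr]; exact sub_self _)
  refine ⟨GC.cop s ψ1 ψ2, GC.TT_cop s t1 (by rwa [sub_add_eq_add_sub] at t2), fun x => ?_⟩
  refine GC.hom_ext_step (φ := GC.cop s ψ1 ψ2 ∘ₗ (X.step s).dQ) s (fun x => ?_) (fun x => ?_) x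
  · simp only [LinearMap.comp_apply, GC.dQ_apply, GC.δ_inl, ha, zero_smul, add_zero, GC.cop_inl]
    rw [e1]; rfl
  · simp only [LinearMap.comp_apply, GC.dQ_apply, GC.δ_inr, map_sub, GC.cop_inl, GC.cop_inr]
    rw [e2]; simp

/-- change of rings lemma -/
theorem GC.lemX (X : GC Q c) (Θ : Set (Fin c)) (t : Fin c) (hL : X.Lift Θ) (hS : X.Surj Θ t)
    {N N3 : Type} [AddCommGroup N] [Module Q N] [AddCommGroup N3] [Module Q N3] (r : N →ₗ[Q] N3)
    (h : Q)
    (hr : Function.Surjective r) (ker : ∀ y, r y = 0 → ∃ z, y = h • z)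
    (hr0 : ∀ z, r (h • z) = 0)
    (inj : ∀ z : N, h • z = 0 → z = 0)
    (hF : ∀ i (φ : X.E →ₗ[Q] N), X.TT Θ i φ → ∀ x, φ (X.F • x) = h • φ ((MvPolynomial.X t : MvPolynomial (Fin c) Q) • x))
    (i : ℤ) (hE : X.Ex N (insert t Θ) i) : X.Ex N3 Θ i := by
  have inj' : ∀ z z' : N, h • z = h • z' → z = z' := fun z z' e =>
    sub_eq_zero.1 (inj _ (by rw [smul_sub, e, sub_self]))
  intro φ hφ hc
  obtain ⟨φ', t1, e1⟩ := hL N N3 r hr _ _ hφ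
  obtain ⟨b, hb⟩ := exists_div h inj (φ' ∘ₗ X.dQ) (fun x => ker _ (by simp [e1, hc]))
  have hbT : X.TT Θ (i - 1) b := t1.D'.div h inj hb
  have hb2 : ∀ x, b (X.δ x) = φ' ((MvPolynomial.X t : MvPolynomial (Fin c) Q) • x) := fun x => by
    apply inj'
    rw [← hF _ _ t1, ← hb]
    simp [X.δδ]
  obtain ⟨β, hβ, eβ⟩ := hS N _ _ hbT
  have hβ' : X.TT Θ (i + 1) β := by rwa [show i - 1 + 2 = i + 1 by ring] at hβ
  have ta1 := t1.sub hβ'.D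
  obtain ⟨a2, t2, e2⟩ := hE (φ' - β ∘ₗ X.dQ) ⟨ta1.1, by
    rintro r (rfl | hr) x
    · simp [eβ, hb2]
    · exact ta1.2 r hr x⟩ (fun x => by
    have := hb x
    simp only [LinearMap.comp_apply, GC.dQ_apply] at this
    simp [X.δδ, hF _ _ hβ', this, eβ])
  refine ⟨r ∘ₗ (β + a2), GC.TT.post (hβ'.add ⟨t2.1, fun r hr => t2.2 r (Or.inr hr)⟩) r, fun x => ?_⟩
  simp [e2, e1]

/-- monomial basis element of base -/
noncomputable def bm (Q : Type) [CommRing Q] {c : ℕ} (d : Fin c →₀ ℕ) : (base Q c).E :=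
  (monomial d (1:Q) : MvPolynomial (Fin c) Q)

theorem base_TT_hom_ext {N : Type} [AddCommGroup N] [Module Q N]
    {φ ψ : (base Q c).E →ₗ[Q] N} (h : ∀ d, φ (bm Q d) = ψ (bm Q d)) :
    φ = ψ :=
  (basisMonomials (Fin c) Q).ext (f₁ := (show MvPolynomial (Fin c) Q →ₗ[Q] N from φ))
    (f₂ := (show MvPolynomial (Fin c) Q →ₗ[Q] N from ψ)) (by rw [coe_basisMonomials]; exact h)

theorem base_π_monomial (i : ℤ) (d : Fin c →₀ ℕ) :
    (base Q c).π i (bm Q d) =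
      if Finsupp.weight (fun _ : Fin c => (2:ℤ)) d = i then bm Q d else 0 := by
  have : (weightedHomogeneousComponent (fun _ => (2:ℤ)) i (monomial d (1:Q)) : MvPolynomial (Fin c) Q) =
      if Finsupp.weight (fun _ : Fin c => (2:ℤ)) d = i then monomial d (1:Q) else 0 := by
    ext e
    rw [coeff_weightedHomogeneousComponent]
    by_cases h : d = e
    · subst h; split_ifs <;> simp
    · split_ifs <;> simp [coeff_monomial, h]
  exact this

theorem X_smul_bm (r : Fin c) (d : Fin c →₀ ℕ) :
    (MvPolynomial.X r : MvPolynomial (Fin c) Q) • bm Q d = bm Q (d + Finsupp.single r 1) := by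
  have : (MvPolynomial.X r * monomial d (1:Q) : MvPolynomial (Fin c) Q) = monomial (d + Finsupp.single r 1) 1 := by
    rw [MvPolynomial.X, monomial_mul, one_mul, add_comm]
  exact this

theorem base_Lift (Θ : Set (Fin c)) : (base Q c).Lift Θ := by
  intro N N3 _ _ _ _ r hr i φ hφ
  have hex : ∀ d : Fin c →₀ ℕ, ∃ y, r y = φ (bm Q d) ∧ (φ (bm Q d) = 0 → y = 0) := by
    intro d
    by_cases h : φ (bm Q d) = 0
    · exact ⟨0, by rw [h, map_zero], fun _ => rfl⟩
    · obtain ⟨y, hy⟩ := hr (φ (bm Q d))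
      exact ⟨y, hy, fun h' => absurd h' h⟩
  choose y hy1 hy2 using hex
  obtain ⟨ψ, hψ⟩ : ∃ ψ : (base Q c).E →ₗ[Q] N, ∀ d, ψ (bm Q d) = y d := by
    refine ⟨(basisMonomials (Fin c) Q).constr Q y, fun d => ?_⟩
    have := (basisMonomials (Fin c) Q).constr_basis Q y d
    rw [coe_basisMonomials] at this
    exact this
  refine ⟨ψ, ⟨?_, ?_⟩, ?_⟩
  · intro x
    refine LinearMap.congr_fun (f := ψ ∘ₗ (base Q c).π i) (base_TT_hom_ext fun d => ?_) x
    rw [LinearMap.comp_apply, base_π_monomial]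
    split_ifs with h
    · rfl
    · rw [hψ, hy2 d]
      · exact map_zero ψ
      · rw [← hφ.1, base_π_monomial, if_neg h]; exact map_zero φ
  · intro t ht x
    refine LinearMap.congr_fun (f := ψ ∘ₗ (base Q c).sQ (MvPolynomial.X t)) (g := 0) (base_TT_hom_ext fun d => ?_) x
    rw [LinearMap.comp_apply, GC.sQ_apply, X_smul_bm, hψ, hy2]
    · rfl
    · rw [← X_smul_bm]; exact hφ.2 t ht _
  · intro x
    refine LinearMap.congr_fun (f := r ∘ₗ ψ) (base_TT_hom_ext fun d => ?_) x
    rw [LinearMap.comp_apply, hψ, hy1]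

/-- division by a variable -/
noncomputable def Dv (t : Fin c) : MvPolynomial (Fin c) Q →ₗ[Q] MvPolynomial (Fin c) Q where
  toFun p := p.divMonomial (Finsupp.single t 1)
  map_add' p q := add_divMonomial p q _
  map_smul' a p := by ext d; simp [coeff_divMonomial]

theorem coeff_Dv (t : Fin c) (p : MvPolynomial (Fin c) Q) (d) : coeff d (Dv t p) = coeff (Finsupp.single t 1 + d) p :=
  coeff_divMonomial _ _ _

theorem Dv_π (i : ℤ) (t : Fin c) (x : MvPolynomial (Fin c) Q) :
    Dv t (weightedHomogeneousComponent (fun _ => (2:ℤ)) (i+2) x) = weightedHomogeneousComponent (fun _ => (2:ℤ)) i (Dv t x) := by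
  ext d
  rw [coeff_Dv, coeff_weightedHomogeneousComponent, coeff_weightedHomogeneousComponent, coeff_Dv, map_add]
  have : (Finsupp.weight fun x : Fin c => (2:ℤ)) (Finsupp.single t 1) = 2 := by simp [Finsupp.weight_single]
  rw [this]
  congr 1
  simp only [eq_iff_iff]; omega

theorem Dv_X (r t : Fin c) (hrt : r ≠ t) (x : MvPolynomial (Fin c) Q) :
    Dv t (MvPolynomial.X r * x) = MvPolynomial.X r * Dv t x := by
  ext d
  rw [coeff_Dv, coeff_X_mul', coeff_X_mul', coeff_Dv]
  have e : r ∈ (Finsupp.single t 1 + d).support ↔ r ∈ d.support := by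
    simp [Finsupp.single_apply, hrt.symm]
  simp only [e]
  split_ifs with h
  · congr 1
    have : Finsupp.single r 1 ≤ d := by
      rw [Finsupp.single_le_iff]; have := Finsupp.mem_support_iff.1 h; omega
    exact add_tsub_assoc_of_le this _
  · rfl

theorem base_Surj (Θ : Set (Fin c)) (t : Fin c) (ht : t ∉ Θ) : (base Q c).Surj Θ t := by
  intro N _ _ i φ hφ
  refine ⟨φ ∘ₗ (show (base Q c).E →ₗ[Q] (base Q c).E from Dv t), ⟨fun x => ?_, fun r hr x => ?_⟩, fun x => ?_⟩
  · exact (congrArg φ (Dv_π i t x)).trans (hφ.1 _)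
  · exact (congrArg φ (Dv_X r t (fun h => ht (h ▸ hr)) x)).trans (hφ.2 r hr _)
  · exact congrArg φ (X_mul_divMonomial _ _)

theorem base_Ex {N : Type} [AddCommGroup N] [Module Q N] (i : ℤ) (hi : 0 < i) :
    (base Q c).Ex N Set.univ i := by
  intro φ hφ _
  have : φ = 0 := by
    refine base_TT_hom_ext fun d => ?_
    by_cases hd : d = 0
    · subst hd
      rw [← hφ.1, base_π_monomial, if_neg]
      · exact map_zero φ
      · simp; omega
    · obtain ⟨r, hr⟩ := Finsupp.support_nonempty_iff.2 hd
      rw [← Finsupp.sub_add_single_one_cancel (Finsupp.mem_support_iff.1 hr), ← X_smul_bm]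
      exact hφ.2 r trivial _
  refine ⟨0, ⟨by simp, by simp⟩, by simp [this]⟩

theorem GC.TT.kills {X : GC Q c} {N : Type} [AddCommGroup N] [Module Q N] {i : ℤ}
    {φ : X.E →ₗ[Q] N} (h : X.TT Set.univ i φ) (b : MvPolynomial (Fin c) Q) (hb : constantCoeff b = 0)
    (x : X.E) : φ (b • x) = 0 := by
  rw [b.as_sum, Finset.sum_smul, map_sum]
  refine Finset.sum_eq_zero fun d hd => ?_
  have hd0 : d ≠ 0 := by
    rintro rfl
    exact (mem_support_iff.1 hd) hb
  obtain ⟨r, hr⟩ := Finsupp.support_nonempty_iff.2 hd0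
  have : (monomial d (coeff d b) : MvPolynomial (Fin c) Q) = MvPolynomial.X r * monomial (d - Finsupp.single r 1) (coeff d b) := by
    rw [MvPolynomial.X, monomial_mul, one_mul, add_comm,
      Finsupp.sub_add_single_one_cancel (Finsupp.mem_support_iff.1 hr)]
  rw [this, mul_smul]
  exact h.2 r trivial _

end HS
end HSpart2

section HSpart3
namespace HS
open MvPolynomial

variable {Q : Type} [CommRing Q] {c : ℕ}

def RegOn : Ideal Q → List Q → Prop
  | _, [] => True
  | J, h :: l => (∀ a, h * a ∈ J → a ∈ J) ∧ RegOn (J ⊔ Ideal.span {h}) l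

/-- reduction map -/
def red {J K : Ideal Q} (h : J ≤ K) : (Q ⧸ J) →ₗ[Q] (Q ⧸ K) :=
  (Ideal.Quotient.factorₐ Q h).toLinearMap

theorem red_mk {J K : Ideal Q} (h : J ≤ K) (a : Q) :
    red h (Ideal.Quotient.mk J a) = Ideal.Quotient.mk K a := rfl

theorem red_surj {J K : Ideal Q} (h : J ≤ K) : Function.Surjective (red h) := by
  intro y
  obtain ⟨a, rfl⟩ := Ideal.Quotient.mk_surjective y
  exact ⟨Ideal.Quotient.mk J a, rfl⟩

theorem smul_mk (J : Ideal Q) (a b : Q) : a • Ideal.Quotient.mk J b = Ideal.Quotient.mk J (a * b) := rfl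

theorem red_ker (J : Ideal Q) (h : Q) {K : Ideal Q} (hK : K = J ⊔ Ideal.span {h}) (hJK : J ≤ K) (y) (hy : red hJK y = 0) :
    ∃ z, y = h • z := by
  subst hK
  obtain ⟨a, rfl⟩ := Ideal.Quotient.mk_surjective y
  rw [red_mk, Ideal.Quotient.eq_zero_iff_mem, Submodule.mem_sup] at hy
  obtain ⟨b, hb, e, he, rfl⟩ := hy
  obtain ⟨q, rfl⟩ := Ideal.mem_span_singleton'.1 he
  refine ⟨Ideal.Quotient.mk J q, ?_⟩
  rw [smul_mk, Ideal.Quotient.eq, mul_comm h q, add_sub_cancel_right]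
  exact hb

theorem red_zero (J : Ideal Q) (h : Q) {K : Ideal Q} (hK : h ∈ K) (hJK : J ≤ K) (z) : red hJK (h • z) = 0 := by
  obtain ⟨a, rfl⟩ := Ideal.Quotient.mk_surjective z
  rw [smul_mk, red_mk, Ideal.Quotient.eq_zero_iff_mem]
  exact Ideal.mul_mem_right _ _ hK

theorem red_inj (J : Ideal Q) (h : Q) (hh : ∀ a, h * a ∈ J → a ∈ J) (z : Q ⧸ J) (hz : h • z = 0) : z = 0 := by
  obtain ⟨a, rfl⟩ := Ideal.Quotient.mk_surjective z
  rw [smul_mk, Ideal.Quotient.eq_zero_iff_mem] at hz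
  rw [Ideal.Quotient.eq_zero_iff_mem]
  exact hh a hz

theorem smul_eq_zero_of_mem {J : Ideal Q} {a : Q} (ha : a ∈ J) (z : Q ⧸ J) : a • z = 0 := by
  obtain ⟨b, rfl⟩ := Ideal.Quotient.mk_surjective z
  rw [smul_mk, Ideal.Quotient.eq_zero_iff_mem]
  exact Ideal.mul_mem_right _ _ ha

theorem GC.steps_Lift {X : GC Q c} {Θ} (h : X.Lift Θ) (l : List (SD Q c)) : (X.steps l).Lift Θ := by
  induction l with
  | nil => exact h
  | cons s l ih => exact ih.step s

theorem GC.steps_Surj {X : GC Q c} {Θ t} (h : X.Surj Θ t) (l : List (SD Q c)) : (X.steps l).Surj Θ t := by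
  induction l with
  | nil => exact h
  | cons s l ih => exact ih.step s

theorem GC.steps_F (X : GC Q c) (l : List (SD Q c)) :
    (X.steps l).F = X.F + (l.map fun s => C s.a * s.b).sum := by
  induction l with
  | nil => simp [GC.steps]
  | cons s l ih =>
    change (X.steps l).F + C s.a * s.b = _
    rw [ih, List.map_cons, List.sum_cons]; ring

theorem SD.constantCoeff_b (s : SD Q c) (hm : s.m = 1) : constantCoeff s.b = 0 := by
  rw [constantCoeff_eq]
  by_contra h
  have := s.hb h
  rw [hm] at this
  simp at this

theorem koszul_Ex (l : List (SD Q c)) (hm : ∀ s ∈ l, s.m = 1) (J : Ideal Q)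
    (hJ : RegOn J (l.map SD.a)) (i : ℤ) (hi : 0 < i) :
    ((base Q c).steps l).Ex (Q ⧸ J) Set.univ i := by
  induction l generalizing J with
  | nil => exact base_Ex i hi
  | cons s l ih =>
    rw [List.map_cons, RegOn] at hJ
    have hJK : J ≤ J ⊔ Ideal.span {s.a} := le_sup_left
    refine GC.step_Ex _ s (hm s (by simp)) _ (GC.steps_Lift (base_Lift _) l) (red hJK) (red_surj hJK)
      (red_ker J s.a rfl hJK) (red_zero J s.a (Ideal.mem_sup_right (Ideal.mem_span_singleton_self _)) hJK)
      (red_inj J s.a hJ.1) (fun i φ hφ x => hφ.kills _ ?_ x) i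
      (ih (fun s hs => hm s (List.mem_cons_of_mem _ hs)) _ hJ.2)
    have := GC.steps_F (base Q c) (s :: l)
    rw [show (((base Q c).steps l).step s).F = ((base Q c).steps (s :: l)).F from rfl, this, map_add, map_list_sum]
    rw [show (base Q c).F = 0 from rfl, map_zero, zero_add]
    apply List.sum_eq_zero
    intro x hx
    simp only [List.mem_map] at hx
    obtain ⟨_, ⟨s', hs', rfl⟩, rfl⟩ := hx
    rw [map_mul, SD.constantCoeff_b s' (hm s' hs'), mul_zero]

def Jt (f : Fin c → Q) (n : ℕ) : Ideal Q := Ideal.span {q | ∃ r : Fin c, r.val < n ∧ f r = q}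

theorem mem_Jt (f : Fin c → Q) (t : Fin c) (n : ℕ) (h : t.val < n) : f t ∈ Jt f n :=
  Ideal.subset_span ⟨t, h, rfl⟩

theorem Jt_succ (f : Fin c → Q) (t : Fin c) : Jt f (t.val + 1) = Jt f t.val ⊔ Ideal.span {f t} := by
  rw [Jt, Jt, ← Ideal.span_union]
  congr 1
  ext q
  constructor
  · rintro ⟨r, hr, rfl⟩
    rcases Nat.lt_succ_iff_lt_or_eq.1 hr with h | h
    · exact Or.inl ⟨r, h, rfl⟩
    · right; rw [Fin.ext h]; rfl
  · rintro (⟨r, hr, rfl⟩ | h)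
    · exact ⟨r, by omega, rfl⟩
    · exact ⟨t, by omega, h.symm⟩

theorem Jt_zero (f : Fin c → Q) : Jt f 0 = ⊥ := by
  simp [Jt]

theorem Jt_top (f : Fin c → Q) : Jt f c = Ideal.span (Set.range f) := by
  rw [Jt]; congr 1; ext q; simp

theorem chainX (X : GC Q c) (hL : ∀ Θ, X.Lift Θ) (hS : ∀ Θ t, t ∉ Θ → X.Surj Θ t) (f : Fin c → Q)
    (hF : X.F = ∑ i, C (f i) * MvPolynomial.X i)
    (hreg : ∀ (t : Fin c) a, f t * a ∈ Jt f t → a ∈ Jt f t) (i : ℤ)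
    (h0 : X.Ex (Q ⧸ Jt f 0) Set.univ i) :
    ∀ n ≤ c, X.Ex (Q ⧸ Jt f n) {r | n ≤ r.val} i := by
  intro n
  induction n with
  | zero => intro _; convert h0; simp
  | succ n ih =>
    intro hn
    let t : Fin c := ⟨n, hn⟩
    have hJK : Jt f n ≤ Jt f (n+1) := by rw [show n + 1 = t.val + 1 from rfl, Jt_succ]; exact le_sup_left
    have hΘ : insert t {r : Fin c | n + 1 ≤ r.val} = {r : Fin c | n ≤ r.val} := by
      ext r
      simp only [Set.mem_insert_iff, Set.mem_setOf_eq, Fin.ext_iff, t]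
      omega
    refine X.lemX {r | n + 1 ≤ r.val} t (hL _) (hS _ _ (by simp [t])) (red hJK) (f t) (red_surj hJK)
      (red_ker _ _ (Jt_succ f t) hJK)
      (red_zero _ _ (mem_Jt f t _ (by simp [t])) hJK) (red_inj _ _ (hreg t)) (fun j φ hφ x => ?_) i
      (by rw [hΘ]; exact ih (by omega))
    rw [hF, Finset.sum_smul, map_sum, Finset.sum_eq_single t]
    · rw [mul_smul, X.CC_smul, map_smul]
    · intro r _ hr
      rw [mul_smul, X.CC_smul, map_smul]
      by_cases h : n + 1 ≤ r.val
      · rw [hφ.2 r h, smul_zero]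
      · have : r.val ≠ n := fun h => hr (Fin.ext h)
        exact smul_eq_zero_of_mem (mem_Jt f r _ (by omega)) _
    · simp

theorem steps_Ex0 (X : GC Q c) (N : Type) [AddCommGroup N] [Module Q N] (i0 : ℤ)
    (h : ∀ i, i0 < i → X.Ex N ∅ i) (l : List (SD Q c)) (hl : ∀ s ∈ l, s.a = 0 ∧ 1 ≤ s.m) :
    ∃ i1, ∀ i, i1 < i → (X.steps l).Ex N ∅ i := by
  induction l with
  | nil => exact ⟨i0, h⟩
  | cons s l ih =>
    obtain ⟨i1, h1⟩ := ih fun s hs => hl s (List.mem_cons_of_mem _ hs)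
    exact ⟨i1 + s.w, GC.step_Ex0 _ s (hl s (by simp)).1 (hl s (by simp)).2 i1 h1⟩

section trunc
variable [IsNoetherianRing Q] {X : GC Q c} {n : ℤ}

noncomputable def GC.tincl (X : GC Q c) (n : ℤ) : (X.trunc n).E →ₗ[Q] X.E :=
  ((X.truncS n).subtype).restrictScalars Q

theorem GC.tincl_inj (x y : (X.trunc n).E) (h : X.tincl n x = X.tincl n y) : x = y := Subtype.ext h
theorem GC.tincl_δ (x : (X.trunc n).E) : X.tincl n ((X.trunc n).δ x) = X.δ (X.tincl n x) := rfl
theorem GC.tincl_π (i) (x : (X.trunc n).E) : X.tincl n ((X.trunc n).π i x) = X.π i (X.tincl n x) := rfl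
theorem GC.tincl_smul (b : MvPolynomial (Fin c) Q) (x : (X.trunc n).E) : X.tincl n (b • x) = b • (X.tincl n x) := rfl
theorem GC.tincl_low (i : ℤ) (hi : i < n) (x : (X.trunc n).E) : X.π i (X.tincl n x) = 0 := x.2 i hi
theorem GC.exists_tincl (x : X.E) (h : ∀ i < n, X.π i x = 0) : ∃ y, X.tincl n y = x := ⟨⟨x, h⟩, rfl⟩

noncomputable def GC.tproj (X : GC Q c) (n i : ℤ) (hi : n ≤ i) : X.E →ₗ[Q] (X.trunc n).E :=
  (X.π i).codRestrict ((X.truncS n).restrictScalars Q) (X.π_mem_truncS' n i hi)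

theorem GC.tincl_tproj (i : ℤ) (hi : n ≤ i) (x : X.E) : X.tincl n (X.tproj n i hi x) = X.π i x := rfl

theorem GC.trunc_π_low (i : ℤ) (hi : i < n) (x : (X.trunc n).E) : (X.trunc n).π i x = 0 := by
  apply GC.tincl_inj
  rw [GC.tincl_π, GC.tincl_low i hi, map_zero]

theorem GC.tproj_tincl (i : ℤ) (hi : n ≤ i) (x : (X.trunc n).E) : X.tproj n i hi (X.tincl n x) = (X.trunc n).π i x := rfl

variable {N : Type} [AddCommGroup N] [Module Q N]

theorem GC.TT_tproj (i : ℤ) (hi : n ≤ i) (φ : (X.trunc n).E →ₗ[Q] N) (_h : (X.trunc n).TT ∅ i φ) :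
    X.TT ∅ i (φ ∘ₗ X.tproj n i hi) := by
  refine ⟨fun x => ?_, fun r hr => absurd hr (Set.notMem_empty r)⟩
  rw [LinearMap.comp_apply, LinearMap.comp_apply]
  congr 1
  apply GC.tincl_inj
  simp only [GC.tincl_tproj, X.π_idem]

theorem GC.TT_tincl (i : ℤ) (φ : X.E →ₗ[Q] N) (h : X.TT ∅ i φ) :
    (X.trunc n).TT ∅ i (φ ∘ₗ X.tincl n) := by
  refine ⟨fun x => ?_, fun r hr => absurd hr (Set.notMem_empty r)⟩
  rw [LinearMap.comp_apply, LinearMap.comp_apply, GC.tincl_π, h.1]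

theorem GC.trunc_Lift (h : X.Lift ∅) : (X.trunc n).Lift ∅ := by
  intro N N3 _ _ _ _ r hr i φ hφ
  by_cases hi : n ≤ i
  · obtain ⟨ψ, t, e⟩ := h N N3 r hr _ _ (GC.TT_tproj i hi φ hφ)
    refine ⟨ψ ∘ₗ X.tincl n, GC.TT_tincl _ _ t, fun x => ?_⟩
    rw [LinearMap.comp_apply, e, LinearMap.comp_apply, GC.tproj_tincl, hφ.1]
  · refine ⟨0, ⟨by simp, by simp⟩, fun x => ?_⟩
    rw [← hφ.1, GC.trunc_π_low i (by omega)]; simp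

theorem GC.trunc_Ex (i : ℤ) (hi : n < i) (h : X.Ex N ∅ i) : (X.trunc n).Ex N ∅ i := by
  intro φ hφ hc
  obtain ⟨ψ, t, e⟩ := h (φ ∘ₗ X.tproj n i hi.le) (GC.TT_tproj i hi.le φ hφ) (fun x => by
    have : X.tproj n i hi.le (X.δ x) = (X.trunc n).δ (X.tproj n (i-1) (by omega) x) := by
      apply GC.tincl_inj
      rw [GC.tincl_tproj, GC.tincl_δ, GC.tincl_tproj, ← X.π_δ, sub_add_cancel]
    rw [LinearMap.comp_apply, this, hc])
  refine ⟨ψ ∘ₗ X.tincl n, GC.TT_tincl _ _ t, fun x => ?_⟩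
  rw [LinearMap.comp_apply, GC.tincl_δ, e, LinearMap.comp_apply, GC.tproj_tincl, hφ.1]
end trunc

noncomputable def GC.iota (X : GC Q c) : (l : List (SD Q c)) → X.E →ₗ[Q] (X.steps l).E
  | [] => LinearMap.id
  | s :: l => GC.inl s ∘ₗ X.iota l

def JJ : Ideal Q → List Q → Ideal Q
  | J, [] => J
  | J, h :: l => JJ (J ⊔ Ideal.span {h}) l

theorem le_JJ (J : Ideal Q) (l : List Q) : J ≤ JJ J l := by
  induction l generalizing J with
  | nil => exact le_rfl
  | cons h l ih => exact le_sup_left.trans (ih _)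

theorem kills_of_map {X : GC Q c} (J : Ideal Q) (b : MvPolynomial (Fin c) Q)
    (hb : ∀ d, coeff d b ∈ J) (φ : X.E →ₗ[Q] (Q ⧸ J)) (x) : φ (b • x) = 0 := by
  rw [b.as_sum, Finset.sum_smul, map_sum]
  refine Finset.sum_eq_zero fun d _ => ?_
  rw [← mul_one (coeff d b), ← C_mul_monomial, mul_smul, X.CC_smul, map_smul]
  exact smul_eq_zero_of_mem (hb d) _

theorem Hrho (X : GC Q c) (hL : X.Lift ∅) (l : List (SD Q c)) (hm : ∀ s ∈ l, s.m = 1) :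
    ∀ (J : Ideal Q) (_ : RegOn J (l.map SD.a)) (_ : ∀ d, coeff d (X.steps l).F ∈ J)
    (K : Ideal Q) (hK : K = JJ J (l.map SD.a)) (hJK : J ≤ K)
    (i : ℤ) (φ : (X.steps l).E →ₗ[Q] (Q ⧸ J)) (_ : (X.steps l).TT ∅ i φ)
    (_ : ∀ x, φ ((X.steps l).δ x) = 0)
    (_ : ∃ ψ : X.E →ₗ[Q] (Q ⧸ K), X.TT ∅ (i + 1) ψ ∧ ∀ x, ψ (X.δ x) = red hJK (φ (X.iota l x))),
    ∃ ψ : (X.steps l).E →ₗ[Q] (Q ⧸ J), (X.steps l).TT ∅ (i + 1) ψ ∧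
      ∀ x, ψ ((X.steps l).δ x) = φ x := by
  induction l with
  | nil =>
    intro J _ _ K hK hJK i φ hφ hc ⟨ψ, t, e⟩
    have hKJ : K = J := hK
    subst hKJ
    refine ⟨ψ, t, fun x => (e x).trans ?_⟩
    have : red hJK = LinearMap.id := by
      ext; rfl
    rw [this]; rfl
  | cons s l ih =>
    intro J hJ hF K hK hJK i φ hφ hc ⟨ψ, t, e⟩
    rw [List.map_cons, RegOn] at hJ
    have h1 : J ≤ J ⊔ Ideal.span {s.a} := le_sup_left
    have h2 : J ⊔ Ideal.span {s.a} ≤ K := by rw [hK]; exact le_JJ _ _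
    have hsa : s.a ∈ J ⊔ Ideal.span {s.a} := Ideal.mem_sup_right (Ideal.mem_span_singleton_self _)
    refine GC.stepH (X.steps l) s (hm s (by simp)) ∅ (GC.steps_Lift hL l) (red h1) (red_surj h1)
      (red_ker J s.a rfl h1) (red_inj J s.a hJ.1) (fun i φ _ x => kills_of_map J _ hF φ x) i φ hφ hc ?_
    refine ih (fun s hs => hm s (List.mem_cons_of_mem _ hs)) _ hJ.2 (fun d => ?_) K hK h2 i
      (red h1 ∘ₗ φ ∘ₗ GC.inl s) (((GC.TT_step s).1 hφ).1.post _) ?_ ⟨ψ, t, fun x => ?_⟩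
    · have h3 : (X.steps l).F = (X.steps (s :: l)).F - C s.a * s.b := by
        change _ = (X.steps l).F + C s.a * s.b - _
        ring
      rw [h3, coeff_sub, coeff_C_mul]
      exact sub_mem (h1 (hF d)) (Ideal.mul_mem_right _ _ hsa)
    · exact GC.step_cycle (X.steps l) s (red h1) (red_zero J s.a hsa h1) φ hc
    · rw [e]
      change red hJK (φ (GC.inl s (X.iota l x))) = red h2 (red h1 (φ (GC.inl s (X.iota l x))))
      obtain ⟨a, ha⟩ := Ideal.Quotient.mk_surjective (φ (GC.inl s (X.iota l x)))
      rw [← ha]; rfl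

end HS
end HSpart3

section HSpart4
namespace HS
section EXT
variable {A : Type} [CommRing A] (T : ℕ → Type) [∀ i, AddCommGroup (T i)] [∀ i, Module A (T i)]
  [∀ i, Module.Projective A (T i)]
  (d : ∀ i, T (i+1) →ₗ[A] T i) {M : Type} [AddCommGroup M] [Module A M] (aug : T 0 →ₗ[A] M)
  (hdd : ∀ i x, d i (d (i+1) x) = 0) (haug : Function.Surjective aug)
  (had : ∀ x, aug (d 0 x) = 0)
  (hex0 : ∀ x, aug x = 0 → ∃ y, d 0 y = x)
  (hex : ∀ i x, d i x = 0 → ∃ y, d (i+1) y = x)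

noncomputable def resC : ChainComplex (ModuleCat A) ℕ :=
  ChainComplex.of (fun i => ModuleCat.of A (T i)) (fun i => ModuleCat.ofHom (d i))
    (fun i => by ext x; exact hdd i x)

theorem resC_d (i : ℕ) : (resC T d hdd).d (i+1) i = ModuleCat.ofHom (d i) := by
  unfold resC
  exact ChainComplex.of_d (fun i => ModuleCat.of A (T i)) (fun i => ModuleCat.ofHom (d i)) i

theorem resC_exact (hex : ∀ i x, d i x = 0 → ∃ y, d (i+1) y = x) (i : ℕ) : (resC T d hdd).ExactAt (i+1) := by
  rw [HomologicalComplex.exactAt_iff' _ (i+2) (i+1) i (by simp) (by simp)]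
  rw [ShortComplex.moduleCat_exact_iff]
  intro x hx
  have e1 := resC_d T d hdd i
  have e2 := resC_d T d hdd (i+1)
  change (resC T d hdd).d (i+1) i x = 0 at hx
  rw [e1] at hx
  obtain ⟨y, hy⟩ := hex i x hx
  refine ⟨y, ?_⟩
  change (resC T d hdd).d (i+2) (i+1) y = x
  rw [e2]
  exact hy

noncomputable def resP : ProjectiveResolution (ModuleCat.of A M) where
  complex := resC T d hdd
  projective := fun i => by
    change Projective (ModuleCat.of A (T i))
    infer_instance
  π := (ChainComplex.toSingle₀Equiv _ _).symm ⟨ModuleCat.ofHom aug, by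
    rw [resC_d]; ext x; exact had x⟩
  quasiIso := ⟨fun n => by
    cases n with
    | zero =>
      rw [ChainComplex.quasiIsoAt₀_iff, ShortComplex.quasiIso_iff_of_zeros']
      · constructor
        · rw [ShortComplex.moduleCat_exact_iff]
          intro x hx
          obtain ⟨y, hy⟩ := hex0 x hx
          refine ⟨y, ?_⟩
          change (resC T d hdd).d 1 0 y = x
          rw [resC_d]
          exact hy
        · rw [ModuleCat.epi_iff_surjective]
          exact haug
      all_goals rfl
    | succ n =>
      rw [quasiIsoAt_iff_exactAt']
      · exact resC_exact T d hdd hex n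
      · apply ChainComplex.exactAt_succ_single_obj⟩

theorem ext_iff (hdd : ∀ i x, d i (d (i+1) x) = 0) (haug : Function.Surjective aug)
  (had : ∀ x, aug (d 0 x) = 0)
  (hex0 : ∀ x, aug x = 0 → ∃ y, d 0 y = x)
  (hex : ∀ i x, d i x = 0 → ∃ y, d (i+1) y = x) (K : Type) [AddCommGroup K] [Module A K] (j : ℕ) :
    Nontrivial (((Ext A (ModuleCat A) (j+1)).obj (Opposite.op (ModuleCat.of A M))).obj
      (ModuleCat.of A K)) ↔
    ∃ Φ : T (j+1) →ₗ[A] K, (∀ x, Φ (d (j+1) x) = 0) ∧ ¬ ∃ Ψ : T j →ₗ[A] K, ∀ x, Φ x = Ψ (d j x) := by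
  have e := (resP T d aug hdd haug had hex0 hex).isoExt (R := A) (j+1) (ModuleCat.of A K)
  rw [← not_subsingleton_iff_nontrivial, ← ModuleCat.isZero_iff_subsingleton, e.isZero_iff,
    ← HomologicalComplex.exactAt_iff_isZero_homology,
    HomologicalComplex.exactAt_iff' _ j (j+1) (j+2) (by simp) (by simp),
    ShortComplex.moduleCat_exact_iff]
  have e1 := resC_d T d hdd j
  have e2 := resC_d T d hdd (j+1)
  constructor
  · intro h
    push Not at h
    obtain ⟨x, hx, hy⟩ := h
    refine ⟨ModuleCat.Hom.hom (x : ModuleCat.of A (T (j+1)) ⟶ ModuleCat.of A K), ?_, ?_⟩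
    · intro z
      have hx' : (resC T d hdd).d (j+2) (j+1) ≫ (x : (resC T d hdd).X (j+1) ⟶ ModuleCat.of A K) = 0 := hx
      rw [e2] at hx'
      exact congrArg (fun (t : ModuleCat.of A (T (j+2)) ⟶ ModuleCat.of A K) => t.hom z) hx'
    · rintro ⟨Ψ, hΨ⟩
      refine hy (ModuleCat.ofHom Ψ : ModuleCat.of A (T j) ⟶ ModuleCat.of A K) ?_
      change (resC T d hdd).d (j+1) j ≫ (ModuleCat.ofHom Ψ : (resC T d hdd).X j ⟶ ModuleCat.of A K) = x
      rw [e1]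
      refine ModuleCat.hom_ext (LinearMap.ext fun z => ?_)
      exact (hΨ z).symm
  · rintro ⟨Φ, h1, h2⟩ h
    obtain ⟨y, hy⟩ := h (ModuleCat.ofHom Φ : ModuleCat.of A (T (j+1)) ⟶ ModuleCat.of A K) (by
      change (resC T d hdd).d (j+2) (j+1) ≫ (ModuleCat.ofHom Φ : (resC T d hdd).X (j+1) ⟶ ModuleCat.of A K) = 0
      rw [e2]
      refine ModuleCat.hom_ext (LinearMap.ext fun z => ?_)
      exact h1 z)
    refine h2 ⟨ModuleCat.Hom.hom (y : ModuleCat.of A (T j) ⟶ ModuleCat.of A K), fun z => ?_⟩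
    have hy' : (resC T d hdd).d (j+1) j ≫ (y : (resC T d hdd).X j ⟶ ModuleCat.of A K) = (ModuleCat.ofHom Φ : ModuleCat.of A (T (j+1)) ⟶ ModuleCat.of A K) := hy
    rw [e1] at hy'
    exact (congrArg (fun (t : ModuleCat.of A (T (j+1)) ⟶ ModuleCat.of A K) => t.hom z) hy').symm
end EXT
end HS
end HSpart4

section HSpart5
namespace HS
open MvPolynomial
open RingTheory.Sequence
variable {Q : Type} [CommRing Q] {c : ℕ}

theorem smulreg_iff (J : Ideal Q) (h : Q) :
    IsSMulRegular (Q ⧸ (J • ⊤ : Submodule Q Q)) h ↔ ∀ a, h * a ∈ J → a ∈ J := by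
  have e : (J • ⊤ : Submodule Q Q) = J := by simp
  rw [e]
  rw [isSMulRegular_iff_right_eq_zero_of_smul]
  constructor
  · intro H a ha
    have := H (Submodule.Quotient.mk a) (by
      rw [← Submodule.Quotient.mk_smul, Submodule.Quotient.mk_eq_zero]; exact ha)
    rwa [Submodule.Quotient.mk_eq_zero] at this
  · intro H x hx
    obtain ⟨a, rfl⟩ := Submodule.Quotient.mk_surjective _ x
    rw [← Submodule.Quotient.mk_smul, Submodule.Quotient.mk_eq_zero] at hx
    rw [Submodule.Quotient.mk_eq_zero]
    exact H a hx

theorem wr_snoc (p : List Q) (h : Q) : IsWeaklyRegular Q (p ++ [h]) ↔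
    IsWeaklyRegular Q p ∧ ∀ a, h * a ∈ Ideal.ofList p → a ∈ Ideal.ofList p := by
  rw [isWeaklyRegular_append_iff, isWeaklyRegular_singleton_iff, smulreg_iff]

theorem wr_iff (l p : List Q) : IsWeaklyRegular Q (p ++ l) ↔
    IsWeaklyRegular Q p ∧ RegOn (Ideal.ofList p) l := by
  induction l generalizing p with
  | nil => simp [RegOn]
  | cons h l ih =>
    rw [show p ++ h :: l = (p ++ [h]) ++ l by simp, ih, wr_snoc, RegOn, Ideal.ofList_append,
      Ideal.ofList_singleton, and_assoc]

theorem JJ_ofList (l p : List Q) : JJ (Ideal.ofList p) l = Ideal.ofList (p ++ l) := by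
  induction l generalizing p with
  | nil => simp [JJ]
  | cons h l ih =>
    rw [JJ, show p ++ h :: l = (p ++ [h]) ++ l by simp, ← ih, Ideal.ofList_append,
      Ideal.ofList_singleton]

theorem ofList_take (f : Fin c → Q) (n : ℕ) : Ideal.ofList ((List.ofFn f).take n) = Jt f n := by
  rw [Ideal.ofList, Jt]
  congr 1
  ext q
  simp only [Set.mem_ofPred_eq, List.mem_take_iff_getElem, List.getElem_ofFn, List.length_ofFn]
  constructor
  · rintro ⟨i, hi, rfl⟩
    exact ⟨⟨i, by omega⟩, by simp; omega, rfl⟩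
  · rintro ⟨r, hr, rfl⟩
    exact ⟨r, by have := r.2; omega, rfl⟩

theorem ofList_ofFn (f : Fin c → Q) : Ideal.ofList (List.ofFn f) = Ideal.span (Set.range f) := by
  rw [← Jt_top, ← ofList_take, List.take_of_length_le (by simp)]

theorem hreg_of (f : Fin c → Q) (h : IsWeaklyRegular Q (List.ofFn f)) (t : Fin c) (a : Q)
    (ha : f t * a ∈ Jt f t) : a ∈ Jt f t := by
  rw [← List.take_append_drop t.val (List.ofFn f), wr_iff, List.drop_eq_getElem_cons (by simp)] at h
  have := h.2.1 a
  simp only [List.getElem_ofFn, ofList_take] at this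
  exact this ha

theorem Jt_coeffs (f : Fin c → Q) (n : ℕ) (x : Q) (hx : x ∈ Jt f n) :
    ∃ w : Fin c → Q, (∀ r, n ≤ r.val → w r = 0) ∧ x = ∑ r, w r * f r := by
  refine Submodule.span_induction (p := fun x _ => ∃ w : Fin c → Q, (∀ r, n ≤ r.val → w r = 0) ∧ x = ∑ r, w r * f r) ?_ ?_ ?_ ?_ hx
  · rintro _ ⟨r, hr, rfl⟩
    refine ⟨Pi.single r 1, fun s hs => ?_, ?_⟩
    · rw [Pi.single_apply, if_neg]; rintro rfl; omega
    · simp [Pi.single_apply]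
  · exact ⟨0, by simp, by simp⟩
  · rintro x y _ _ ⟨w, h1, rfl⟩ ⟨v, h2, rfl⟩
    exact ⟨w + v, fun r hr => by simp [h1 r hr, h2 r hr], by simp [add_mul, Finset.sum_add_distrib]⟩
  · rintro a x _ ⟨w, h1, rfl⟩
    exact ⟨a • w, fun r hr => by simp [h1 r hr], by simp [Finset.mul_sum, mul_assoc]⟩

theorem span_coeffs (f : Fin c → Q) (x : Q) (hx : x ∈ Ideal.span (Set.range f)) :
    ∃ w : Fin c → Q, x = ∑ r, w r * f r := by
  rw [← Jt_top] at hx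
  obtain ⟨w, _, h⟩ := Jt_coeffs f c x hx
  exact ⟨w, h⟩

variable [IsLocalRing Q]

theorem exists_unit_coeff (l : List Q) (x : Q) (hx : x ∈ Ideal.ofList l) :
    x ∈ maximalIdeal Q * Ideal.ofList l ∨ ∃ l1 h l2 u r, l = l1 ++ h :: l2 ∧ IsUnit u ∧
      r ∈ Ideal.ofList (l1 ++ l2) ∧ x = u * h + r := by
  induction l generalizing x with
  | nil => left; simpa using hx
  | cons h l ih =>
    rw [Ideal.ofList_cons, Submodule.mem_sup] at hx
    obtain ⟨y, hy, z, hz, rfl⟩ := hx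
    obtain ⟨a, rfl⟩ := Ideal.mem_span_singleton'.1 hy
    by_cases ha : IsUnit a
    · exact Or.inr ⟨[], h, l, a, z, rfl, ha, hz, rfl⟩
    · rcases ih z hz with h1 | ⟨l1, h', l2, u, r, rfl, hu, hr, rfl⟩
      · left
        rw [Ideal.ofList_cons, Ideal.mul_sup]
        exact Submodule.add_mem_sup (Ideal.mul_mem_mul ((mem_maximalIdeal _).2 ha)
          (Ideal.mem_span_singleton_self h)) h1
      · refine Or.inr ⟨h :: l1, h', l2, u, r + a * h, rfl, hu, ?_, by ring⟩
        rw [List.cons_append, Ideal.ofList_cons, add_comm]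
        exact Submodule.add_mem_sup hy hr

variable [IsNoetherianRing Q]

theorem exch1 (I : Ideal Q) (hI : I ≤ maximalIdeal Q) (p l : List Q) (g : Q)
    (h1 : IsWeaklyRegular Q (p ++ l)) (h2 : Ideal.ofList (p ++ l) = I) (hg : g ∈ I)
    (hg2 : g ∉ Ideal.ofList p ⊔ maximalIdeal Q * I) :
    ∃ l', IsWeaklyRegular Q (p ++ [g] ++ l') ∧ Ideal.ofList (p ++ [g] ++ l') = I := by
  have hg' := hg
  rw [← h2, Ideal.ofList_append, Submodule.mem_sup] at hg'
  obtain ⟨y, hy, z, hz, rfl⟩ := hg'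
  rcases exists_unit_coeff l z hz with h | ⟨l1, h, l2, u, r, rfl, hu, hr, rfl⟩
  · refine absurd (Submodule.add_mem_sup hy (Ideal.mul_mono_right ?_ h)) hg2
    rw [← h2, Ideal.ofList_append]; exact le_sup_right
  have hm : ∀ q ∈ p ++ (l1 ++ h :: l2), q ∈ maximalIdeal Q := fun q hq =>
    hI (h2 ▸ Ideal.subset_span hq)
  have hperm : (p ++ (l1 ++ h :: l2)).Perm ((p ++ (l1 ++ l2)) ++ [h]) := by
    rw [List.append_assoc]
    refine List.Perm.append_left p ?_
    exact List.perm_middle.trans (List.perm_append_comm (l₁ := [h]))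
  have h3 := IsLocalRing.isWeaklyRegular_of_perm_of_subset_maximalIdeal h1 hperm hm
  rw [wr_snoc] at h3
  have hr' : y + r ∈ Ideal.ofList (p ++ (l1 ++ l2)) := by
    rw [Ideal.ofList_append]; exact Submodule.add_mem_sup hy hr
  set g := y + (u * h + r) with hgd
  obtain ⟨v, hv⟩ := hu.exists_left_inv
  have h4 : IsWeaklyRegular Q ((p ++ (l1 ++ l2)) ++ [g]) := by
    rw [wr_snoc]
    refine ⟨h3.1, fun a ha => ?_⟩
    have h5 : h * (u * a) ∈ Ideal.ofList (p ++ (l1 ++ l2)) := by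
      have := Ideal.sub_mem _ ha (Ideal.mul_mem_right a _ hr')
      convert this using 1; rw [hgd]; ring
    have := Ideal.mul_mem_left _ v (h3.2 _ h5)
    rwa [← mul_assoc, hv, one_mul] at this
  have hI2 : Ideal.ofList ((p ++ (l1 ++ l2)) ++ [h]) = I := by
    rw [← h2]; rw [Ideal.ofList, Ideal.ofList]; congr 1; ext q; exact hperm.mem_iff.symm
  have hI3 : Ideal.ofList ((p ++ (l1 ++ l2)) ++ [g]) = I := by
    rw [← hI2, Ideal.ofList_append _ [g], Ideal.ofList_append _ [h], Ideal.ofList_singleton, Ideal.ofList_singleton]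
    apply le_antisymm
    · refine sup_le le_sup_left ?_
      rw [Ideal.span_singleton_le_iff_mem, show g = (y + r) + u * h by rw [hgd]; ring]
      exact Submodule.add_mem_sup hr' (Ideal.mul_mem_left _ _ (Ideal.mem_span_singleton_self h))
    · refine sup_le le_sup_left ?_
      rw [Ideal.span_singleton_le_iff_mem, show h = (-v) * (y + r) + v * g by
        rw [hgd]; linear_combination (-h) * hv]
      exact Submodule.add_mem_sup (Ideal.mul_mem_left _ _ hr') (Ideal.mul_mem_left _ _ (Ideal.mem_span_singleton_self g))
  have hperm2 : ((p ++ (l1 ++ l2)) ++ [g]).Perm (p ++ [g] ++ (l1 ++ l2)) := by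
    rw [List.append_assoc p, List.append_assoc p]
    exact List.Perm.append_left p List.perm_append_comm
  refine ⟨l1 ++ l2, IsLocalRing.isWeaklyRegular_of_perm_of_subset_maximalIdeal h4 hperm2 ?_, ?_⟩
  · exact fun q hq => hI (hI3 ▸ Ideal.subset_span hq)
  · rw [← hI3]; rw [Ideal.ofList, Ideal.ofList]; congr 1; ext q; exact hperm2.mem_iff.symm

theorem exch (I : Ideal Q) (hI : I ≤ maximalIdeal Q) (fs : List Q) (hf : IsWeaklyRegular Q fs)
    (hfI : Ideal.ofList fs = I) {d : ℕ} (g : Fin d → Q) (hg : ∀ i, g i ∈ I)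
    (hind : ∀ a : Fin d → Q, (∑ i, a i * g i) ∈ maximalIdeal Q * I → ∀ i, a i ∈ maximalIdeal Q) :
    ∀ t ≤ d, ∃ l, IsWeaklyRegular Q ((List.ofFn g).take t ++ l) ∧
      Ideal.ofList ((List.ofFn g).take t ++ l) = I := by
  intro t
  induction t with
  | zero => intro _; exact ⟨fs, by simpa using hf, by simpa using hfI⟩
  | succ t ih =>
    intro ht
    obtain ⟨l, h1, h2⟩ := ih (by omega)
    have e : (List.ofFn g).take (t+1) = (List.ofFn g).take t ++ [g ⟨t, ht⟩] := by
      rw [List.take_add_one]; simp [show t < d from ht]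
    rw [e]
    refine exch1 I hI _ l _ h1 h2 (hg _) fun hc => ?_
    rw [ofList_take, Submodule.mem_sup] at hc
    obtain ⟨y, hy, z, hz, hyz⟩ := hc
    obtain ⟨w, hw, rfl⟩ := Jt_coeffs g t y hy
    have := hind (Pi.single ⟨t, ht⟩ 1 - w) (by
      simp only [Pi.sub_apply, sub_mul, Finset.sum_sub_distrib, Pi.single_apply, ite_mul, one_mul, zero_mul,
        Finset.sum_ite_eq', Finset.mem_univ, if_true]
      rw [← hyz]; simpa using hz) ⟨t, ht⟩
    simp [hw] at this

theorem exch_final (I : Ideal Q) (hI : I ≤ maximalIdeal Q) (f : Fin c → Q)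
    (hf : IsWeaklyRegular Q (List.ofFn f))
    (hfI : I = Ideal.span (Set.range f)) {d : ℕ} (g : Fin d → Q) (hg : ∀ i, g i ∈ I)
    (hind : ∀ a : Fin d → Q, (∑ i, a i * g i) ∈ maximalIdeal Q * I → ∀ i, a i ∈ maximalIdeal Q)
    (J : Ideal Q) (hJ : J = Ideal.span (Set.range g)) :
    ∃ (e : ℕ) (h : Fin e → Q), RegOn J (List.ofFn h) ∧ JJ J (List.ofFn h) = I ∧
      J ⊔ Ideal.span (Set.range h) = I ∧
      ∀ v : Fin e → Q, ∑ l, v l * h l ∈ J ⊔ maximalIdeal Q * I → ∀ l, v l ∈ maximalIdeal Q := by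
  obtain ⟨l, h1, h2⟩ := exch I hI (List.ofFn f) hf (by rw [ofList_ofFn, hfI]) g hg hind d le_rfl
  rw [List.take_of_length_le (by simp)] at h1 h2
  have hJ' : J = Ideal.ofList (List.ofFn g) := by rw [ofList_ofFn, hJ]
  have hl : List.ofFn l.get = l := List.ofFn_get l
  have hl2 : Ideal.ofList l = Ideal.span (Set.range l.get) := by rw [← ofList_ofFn, hl]
  have hsup : J ⊔ Ideal.span (Set.range l.get) = I := by
    rw [← hl2, ← h2, hJ', Ideal.ofList_append]
  refine ⟨l.length, l.get, ?_, ?_, hsup, ?_⟩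
  · rw [hl, hJ']; exact ((wr_iff _ _).1 h1).2
  · rw [hl, hJ', JJ_ofList, h2]
  intro v hv i
  by_contra hvi
  rw [← hsup, Ideal.mul_sup, ← sup_assoc, sup_eq_left.2 (Ideal.mul_le_right : maximalIdeal Q * J ≤ J), Submodule.mem_sup] at hv
  obtain ⟨y, hy, z, hz, hyz⟩ := hv
  rw [← smul_eq_mul, Submodule.mem_ideal_smul_span_iff_exists_sum] at hz
  obtain ⟨a, ha, hz⟩ := hz
  rw [Finsupp.sum_fintype _ _ (by simp)] at hz
  simp only [smul_eq_mul] at hz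
  have hu : IsUnit (v i - a i) := by
    by_contra hn
    exact hvi (by simpa using Ideal.add_mem _ ((mem_maximalIdeal _).2 hn) (ha i))
  obtain ⟨u, hu⟩ := hu.exists_left_inv
  have hi := i.2
  have hsplit : l = l.take i.val ++ l.get i :: l.drop (i.val+1) := by
    conv_lhs => rw [← List.take_append_drop i.val l, List.drop_eq_getElem_cons hi]
    rfl
  set q := List.ofFn g ++ (l.take i.val ++ l.drop (i.val+1)) with hq
  have hperm : (List.ofFn g ++ l).Perm (q ++ [l.get i]) := by
    rw [hq, List.append_assoc]
    refine List.Perm.append_left _ ?_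
    conv_lhs => rw [hsplit]
    exact List.perm_middle.trans (List.perm_append_comm (l₁ := [l.get i]))
  have h3 := IsLocalRing.isWeaklyRegular_of_perm_of_subset_maximalIdeal h1 hperm
    (fun q hq => hI (h2 ▸ Ideal.subset_span hq))
  rw [wr_snoc] at h3
  have hmem : l.get i * 1 ∈ Ideal.ofList q := by
    have e1 : l.get i = u * (y - ∑ r ∈ Finset.univ.erase i, (v r - a r) * l.get r) := by
      have e2 : (∑ r, (v r - a r) * l.get r) = y := by
        simp only [sub_mul, Finset.sum_sub_distrib]
        rw [← hyz, ← hz]; ring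
      rw [← Finset.add_sum_erase _ _ (Finset.mem_univ i)] at e2
      rw [← e2]
      linear_combination (-l.get i) * hu
    rw [mul_one, e1]
    refine Ideal.mul_mem_left _ _ (Ideal.sub_mem _ ?_ (Ideal.sum_mem _ fun r hr => Ideal.mul_mem_left _ _ ?_))
    · rw [hq, Ideal.ofList_append]; exact Ideal.mem_sup_left (hJ' ▸ hy)
    · refine Ideal.subset_span ?_
      have hne : r.val ≠ i.val := fun h => (Finset.mem_erase.1 hr).1 (Fin.ext h)
      change l.get r ∈ q
      rw [hq, List.mem_append, List.mem_append]
      right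
      rcases lt_or_gt_of_ne hne with hlt | hgt
      · left
        rw [List.mem_take_iff_getElem]
        exact ⟨r, by have := r.2; omega, rfl⟩
      · right
        rw [List.mem_drop_iff_getElem]
        refine ⟨r.val - (i.val+1), by have := r.2; omega, ?_⟩
        simp only [List.get_eq_getElem]
        congr 1; omega
  have h4 := h3.2 1 hmem
  have h5 : Ideal.ofList q ≤ maximalIdeal Q := by
    refine le_trans (Ideal.span_mono ?_) (h2.le.trans hI)
    intro x hx
    exact hperm.mem_iff.2 (List.mem_append_left _ hx)
  exact (Ideal.ne_top_iff_one _).1 (maximalIdeal.isMaximal Q).ne_top (h5 h4)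
end HS
end HSpart5

section HSpart6
namespace HS
open MvPolynomial
open RingTheory.Sequence
variable {Q : Type} [CommRing Q] {c : ℕ} [IsLocalRing Q] [IsNoetherianRing Q]
set_option linter.unusedSectionVars false

noncomputable def liftP (r : MvPolynomial (Fin c) (Q ⧸ maximalIdeal Q)) : MvPolynomial (Fin c) Q :=
  (map_surjective _ (Ideal.Quotient.mk_surjective (I := maximalIdeal Q)) r).choose

theorem map_liftP (r : MvPolynomial (Fin c) (Q ⧸ maximalIdeal Q)) :
    map (Ideal.Quotient.mk (maximalIdeal Q)) (liftP r) = r :=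
  (map_surjective _ (Ideal.Quotient.mk_surjective (I := maximalIdeal Q)) r).choose_spec

noncomputable def sdP (r : MvPolynomial (Fin c) (Q ⧸ maximalIdeal Q)) (m : ℕ) : SD Q c where
  a := 0
  b := homogeneousComponent m (liftP r)
  m := m
  hb := homogeneousComponent_isHomogeneous _ _
  h := Or.inl rfl

theorem map_sdP (r : MvPolynomial (Fin c) (Q ⧸ maximalIdeal Q)) (m : ℕ) (hr : r.IsHomogeneous m) :
    map (Ideal.Quotient.mk (maximalIdeal Q)) (sdP r m).b = r := by
  ext d
  rw [coeff_map]
  simp only [sdP]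
  rw [coeff_homogeneousComponent]
  have h1 : Ideal.Quotient.mk (maximalIdeal Q) (coeff d (liftP r)) = coeff d r := by
    rw [← coeff_map, map_liftP]
  split_ifs with h
  · exact h1
  · rw [map_zero, hr.coeff_eq_zero h]

theorem mk_eval (a : Fin c → Q) (b : MvPolynomial (Fin c) Q) :
    Ideal.Quotient.mk (maximalIdeal Q) (eval a b) =
      eval (fun i => Ideal.Quotient.mk (maximalIdeal Q) (a i))
        (map (Ideal.Quotient.mk (maximalIdeal Q)) b) := by
  rw [MvPolynomial.eval_map]
  exact (eval₂_comp_left (Ideal.Quotient.mk (maximalIdeal Q)) (RingHom.id Q) a b)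

theorem gens (𝔞 : Ideal (MvPolynomial (Fin c) (Q ⧸ maximalIdeal Q)))
    (h𝔞 : ∀ p ∈ 𝔞, ∀ n : ℕ, homogeneousComponent n p ∈ 𝔞) :
    ∃ L : List (SD Q c), (∀ s ∈ L, s.a = 0 ∧ 1 ≤ s.m ∧
        map (Ideal.Quotient.mk (maximalIdeal Q)) s.b ∈ 𝔞) ∧
      ∀ a : Fin c → Q, (¬ ∀ i, a i ∈ maximalIdeal Q) → (∀ s ∈ L, eval a s.b ∈ maximalIdeal Q) →
        ∀ p ∈ 𝔞, eval (fun i => Ideal.Quotient.mk (maximalIdeal Q) (a i)) p = 0 := by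
  classical
  have hfg : 𝔞.FG := IsNoetherian.noetherian 𝔞
  obtain ⟨G, hG⟩ := hfg
  have hGm : ∀ g ∈ G, g ∈ 𝔞 := fun g hg => hG ▸ Ideal.subset_span hg
  let D := G.sup totalDegree
  let P : Finset (MvPolynomial (Fin c) (Q ⧸ maximalIdeal Q) × ℕ × Fin c) :=
    G ×ˢ Finset.range (D + 1) ×ˢ Finset.univ
  let R : MvPolynomial (Fin c) (Q ⧸ maximalIdeal Q) × ℕ × Fin c → MvPolynomial (Fin c) (Q ⧸ maximalIdeal Q) :=
    fun x => X x.2.2 * homogeneousComponent x.2.1 x.1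
  have hR : ∀ x, (R x).IsHomogeneous (x.2.1 + 1) := fun x => by
    rw [add_comm]
    exact (isHomogeneous_X _ _).mul (homogeneousComponent_isHomogeneous _ _)
  refine ⟨P.toList.map fun x => sdP (R x) (x.2.1 + 1), ?_, ?_⟩
  · intro s hs
    obtain ⟨x, hx, rfl⟩ := List.mem_map.1 hs
    rw [Finset.mem_toList] at hx
    have hx1 : x.1 ∈ G := (Finset.mem_product.1 hx).1
    refine ⟨rfl, Nat.le_add_left _ _, ?_⟩
    rw [map_sdP _ _ (hR x)]
    exact Ideal.mul_mem_left _ _ (h𝔞 _ (hGm _ hx1) _)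
  · intro a ha hL p hp
    push Not at ha
    obtain ⟨t, ht⟩ := ha
    have key : ∀ g ∈ G, eval (fun i => Ideal.Quotient.mk (maximalIdeal Q) (a i)) g = 0 := by
      intro g hg
      rw [← sum_homogeneousComponent g, map_sum]
      refine Finset.sum_eq_zero fun m hm => ?_
      have hmD : m ∈ Finset.range (D + 1) := by
        have : totalDegree g ≤ D := Finset.le_sup hg
        rw [Finset.mem_range] at hm ⊢; omega
      have h1 := hL (sdP (R (g, m, t)) (m+1)) (List.mem_map.2 ⟨(g, m, t), by
        rw [Finset.mem_toList]
        exact Finset.mem_product.2 ⟨hg, Finset.mem_product.2 ⟨hmD, Finset.mem_univ _⟩⟩, rfl⟩)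
      rw [← Ideal.Quotient.eq_zero_iff_mem, mk_eval, map_sdP _ _ (hR (g, m, t))] at h1
      simp only [R, map_mul, eval_X] at h1
      have := (maximalIdeal.isMaximal Q).isPrime
      have : IsDomain (Q ⧸ maximalIdeal Q) := Ideal.Quotient.isDomain _
      rcases mul_eq_zero.1 h1 with h | h
      · exact absurd (Ideal.Quotient.eq_zero_iff_mem.1 h) ht
      · exact h
    have : 𝔞 ≤ RingHom.ker (eval (fun i => Ideal.Quotient.mk (maximalIdeal Q) (a i))) := by
      rw [← hG]
      exact Ideal.span_le.2 fun g hg => key g hg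
    exact this hp

theorem NS [IsAlgClosed (ResidueField Q)] (𝔟 : Ideal (MvPolynomial (Fin c) Q))
    (hC : ∀ q ∈ maximalIdeal Q, C q ∈ 𝔟)
    (hz : ∀ a : Fin c → Q, (∀ b ∈ 𝔟, eval a b ∈ maximalIdeal Q) → ∀ i, a i ∈ maximalIdeal Q) :
    ∃ D : ℕ, ∀ (d : Fin c →₀ ℕ) (a : Q), D ≤ d.degree → monomial d a ∈ 𝔟 := by
  let φ : MvPolynomial (Fin c) Q →+* MvPolynomial (Fin c) (ResidueField Q) := map (residue Q)
  have hφ : Function.Surjective φ := map_surjective _ residue_surjective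
  have hker : RingHom.ker φ ≤ 𝔟 := by
    rw [ker_map]
    refine Ideal.map_le_iff_le_comap.2 fun q hq => hC q ?_
    rwa [ker_residue] at hq
  have hback : ∀ q, φ q ∈ 𝔟.map φ → q ∈ 𝔟 := fun q hq => by
    obtain ⟨b, hb, e⟩ := (Ideal.mem_map_iff_of_surjective φ hφ).1 hq
    have : q - b ∈ 𝔟 := hker (by rw [RingHom.mem_ker, map_sub, e, sub_self])
    simpa using 𝔟.add_mem this hb
  have hrad : ∀ t : Fin c, X t ∈ (𝔟.map φ).radical := fun t => by
    rw [← vanishingIdeal_zeroLocus_eq_radical (K := ResidueField Q), mem_vanishingIdeal_iff]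
    intro x hx
    choose a ha using fun i => residue_surjective (R := Q) (x i)
    have h1 : ∀ i, a i ∈ maximalIdeal Q := hz a fun b hb => by
      have h2 := hx (φ b) (Ideal.mem_map_of_mem φ hb)
      rw [← residue_eq_zero_iff]
      rw [← h2]
      have : x = fun i => residue Q (a i) := funext fun i => (ha i).symm
      rw [this]
      change _ = aeval _ (map (residue Q) b)
      rw [aeval_eq_eval]; exact mk_eval a b
    simp [← ha, (residue_eq_zero_iff _).2 (h1 t)]
  choose N hN using hrad
  have hN' : ∀ t, X t ^ N t ∈ 𝔟 := fun t => hback _ (by simpa [φ] using hN t)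
  refine ⟨∑ t, N t + 1, fun d a hd => ?_⟩
  obtain ⟨t, ht⟩ : ∃ t, N t ≤ d t := by
    by_contra! hcon
    have : d.degree ≤ ∑ t, N t := by
      rw [Finsupp.degree_eq_sum]
      exact Finset.sum_le_sum fun t _ => (hcon t).le
    omega
  have : monomial d a = monomial (d - Finsupp.single t (N t)) a * X t ^ N t := by
    rw [X_pow_eq_monomial, monomial_mul, mul_one, tsub_add_cancel_of_le]
    exact Finsupp.single_le_iff.2 ht
  rw [this]
  exact 𝔟.mul_mem_left _ (hN' t)
end HS
end HSpart6

section HSpart7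
namespace HS
open MvPolynomial
variable {Q : Type} [CommRing Q] {c : ℕ} [IsLocalRing Q]
set_option linter.unusedSectionVars false

/-- the submodule `𝔫 E` -/
def nE (Q : Type) [CommRing Q] [IsLocalRing Q] (E : Type) [AddCommGroup E] [Module Q E] : Submodule Q E :=
  maximalIdeal Q • (⊤ : Submodule Q E)

theorem nE_map {E E' : Type} [AddCommGroup E] [Module Q E] [AddCommGroup E'] [Module Q E']
    (φ : E →ₗ[Q] E') {x : E} (hx : x ∈ nE Q E) : φ x ∈ nE Q E' := by
  have : (nE Q E).map φ ≤ nE Q E' := by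
    rw [nE, Submodule.map_smul'']
    exact Submodule.smul_mono le_rfl le_top
  exact this (Submodule.mem_map_of_mem hx)

theorem smul_mem_nE {E : Type} [AddCommGroup E] [Module Q E] {a : Q} (ha : a ∈ maximalIdeal Q)
    (x : E) : a • x ∈ nE Q E := Submodule.smul_mem_smul ha trivial

theorem nE_kill {E : Type} [AddCommGroup E] [Module Q E] (θ : E →ₗ[Q] Q ⧸ maximalIdeal Q)
    {x : E} (hx : x ∈ nE Q E) : θ x = 0 := by
  have : nE Q E ≤ LinearMap.ker θ := by
    rw [nE, Submodule.smul_le]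
    intro a ha x _
    rw [LinearMap.mem_ker, map_smul]
    exact smul_eq_zero_of_mem ha _
  exact this hx

/-- point condition -/
def GC.PtB (X : GC Q c) (a : Fin c → Q) : Prop :=
  ∃ θ : X.E →ₗ[Q] Q ⧸ maximalIdeal Q, (∀ p x, θ (p • x) = eval a p • θ x) ∧ (∀ x, θ (X.δ x) = 0) ∧
    ∀ N : ℤ, ∃ i, N ≤ i ∧ ∃ z, X.π i z = z ∧ X.δ z ∈ nE Q X.E ∧ θ z ≠ 0

theorem base_PtB (a : Fin c → Q) (ha : ¬ ∀ i, a i ∈ maximalIdeal Q) : (base Q c).PtB a := by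
  push Not at ha
  obtain ⟨t, ht⟩ := ha
  refine ⟨(Submodule.mkQ (maximalIdeal Q)) ∘ₗ (aeval a : MvPolynomial (Fin c) Q →ₐ[Q] Q).toLinearMap, ?_, ?_, ?_⟩
  · intro p x
    change Submodule.Quotient.mk (aeval a (p * (show MvPolynomial (Fin c) Q from x))) =
      eval a p • Submodule.Quotient.mk (aeval a (show MvPolynomial (Fin c) Q from x))
    rw [← Submodule.Quotient.mk_smul, map_mul, aeval_eq_eval]; rfl
  · intro x
    have : (base Q c).δ x = 0 := rfl
    rw [this, map_zero]
  · intro N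
    refine ⟨2 * (N.toNat : ℤ), by omega, (X t ^ N.toNat : MvPolynomial (Fin c) Q), ?_, ?_, ?_⟩
    · change weightedHomogeneousComponent (fun _ => (2:ℤ)) _ _ = _
      ext d
      rw [coeff_weightedHomogeneousComponent, coeff_X_pow]
      have : Finsupp.weight (fun _ : Fin c => (2:ℤ)) (Finsupp.single t N.toNat) = 2 * (N.toNat : ℤ) := by
        simp [Finsupp.weight_single, mul_comm]
      grind
    · have : (base Q c).δ (X t ^ N.toNat : MvPolynomial (Fin c) Q) = 0 := rfl
      rw [this]; exact zero_mem _
    · change Submodule.Quotient.mk (aeval a (X t ^ N.toNat)) ≠ 0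
      rw [ne_eq, Submodule.Quotient.mk_eq_zero, map_pow, aeval_X]
      exact fun h => ht ((maximalIdeal.isMaximal Q).isPrime.mem_of_pow_mem _ h)

theorem GC.PtB.step {X : GC Q c} {a : Fin c → Q} (h : X.PtB a) (s : SD Q c)
    (hs : s.a ∈ maximalIdeal Q) (hb : eval a s.b ∈ maximalIdeal Q) : (X.step s).PtB a := by
  obtain ⟨θ, h1, h2, h3⟩ := h
  refine ⟨GC.cop s θ 0, ?_, ?_, ?_⟩
  · intro p x
    rw [GC.eq_inl_add_inr s x, smul_add, GC.smul_inl, GC.smul_inr, map_add, map_add]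
    simp [GC.cop_inl, GC.cop_inr, h1]
  · intro x
    rw [GC.eq_inl_add_inr s x, map_add, GC.δ_inl, GC.δ_inr]
    simp [GC.cop_inl, GC.cop_inr, h1, h2]
    exact smul_eq_zero_of_mem hb _
  · intro N
    obtain ⟨i, hi, z, e1, e2, e3⟩ := h3 N
    refine ⟨i, hi, GC.inl s z, ?_, ?_, ?_⟩
    · rw [GC.π_inl, e1]
    · rw [GC.δ_inl]
      exact add_mem (nE_map _ e2) (smul_mem_nE hs _)
    · rwa [GC.cop_inl]

theorem GC.PtB.steps {X : GC Q c} {a : Fin c → Q} (h : X.PtB a) (l : List (SD Q c))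
    (hl : ∀ s ∈ l, s.a ∈ maximalIdeal Q ∧ eval a s.b ∈ maximalIdeal Q) : (X.steps l).PtB a := by
  induction l with
  | nil => exact h
  | cons s l ih =>
    exact (ih fun s' hs' => hl s' (List.mem_cons_of_mem _ hs')).step s (hl s List.mem_cons_self).1
      (hl s List.mem_cons_self).2

theorem GC.PtB.trunc [IsNoetherianRing Q] {X : GC Q c} {a : Fin c → Q} (h : X.PtB a) (n : ℤ) :
    (X.trunc n).PtB a := by
  obtain ⟨θ, h1, h2, h3⟩ := h
  refine ⟨θ ∘ₗ X.tincl n, ?_, ?_, ?_⟩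
  · intro p x
    rw [LinearMap.comp_apply, GC.tincl_smul, h1]; rfl
  · intro x
    rw [LinearMap.comp_apply, GC.tincl_δ, h2]
  · intro N
    obtain ⟨i, hi, z, e1, e2, e3⟩ := h3 (max N n)
    have hin : n ≤ i := by omega
    have e4 : X.tincl n (X.tproj n i hin z) = z := by rw [GC.tincl_tproj, e1]
    refine ⟨i, by omega, X.tproj n i hin z, ?_, ?_, ?_⟩
    · apply GC.tincl_inj
      rw [GC.tincl_π, e4, e1]
    · have : (X.trunc n).δ (X.tproj n i hin z) = X.tproj n (i+1) (by omega) (X.δ z) := by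
        apply GC.tincl_inj
        rw [GC.tincl_δ, e4, GC.tincl_tproj, X.π_δ, e1]
      rw [this]
      exact nE_map _ e2
    · rwa [LinearMap.comp_apply, e4]

theorem GC.PtB.final {X : GC Q c} {a : Fin c → Q} (h : X.PtB a) (N : ℤ) :
    ∃ i, N ≤ i ∧ ∃ z, X.π i z = z ∧ X.δ z ∈ nE Q X.E ∧ ¬ ∃ y, z - X.δ y ∈ nE Q X.E := by
  obtain ⟨θ, h1, h2, h3⟩ := h
  obtain ⟨i, hi, z, e1, e2, e3⟩ := h3 N
  refine ⟨i, hi, z, e1, e2, ?_⟩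
  rintro ⟨y, hy⟩
  have := nE_kill θ hy
  rw [map_sub, h2, sub_zero] at this
  exact e3 this

/-- null-homotopy -/
def GC.Null (X : GC Q c) (b : MvPolynomial (Fin c) Q) : Prop :=
  ∃ σ : X.E →ₗ[MvPolynomial (Fin c) Q] X.E, ∀ x, X.δ (σ x) + σ (X.δ x) = b • x

/-- filtered null-homotopy -/
def GC.NullF (X : GC Q c) (b : MvPolynomial (Fin c) Q) : Prop :=
  ∃ σ : X.E →ₗ[MvPolynomial (Fin c) Q] X.E, (∀ x, X.δ (σ x) + σ (X.δ x) = b • x) ∧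
    ∀ (n : ℤ) x, (∀ i < n, X.π i x = 0) → ∀ i < n, X.π i (σ x) = 0

noncomputable def GC.stepσ (X : GC Q c) (s : SD Q c) (σ : X.E →ₗ[MvPolynomial (Fin c) Q] X.E) :
    (X.step s).E →ₗ[MvPolynomial (Fin c) Q] (X.step s).E := LinearMap.prodMap σ (-σ)

noncomputable def GC.newσ (X : GC Q c) (s : SD Q c) :
    (X.step s).E →ₗ[MvPolynomial (Fin c) Q] (X.step s).E :=
  LinearMap.inr (MvPolynomial (Fin c) Q) X.E X.E ∘ₗ LinearMap.fst _ X.E X.E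

theorem GC.stepσ_inl (X : GC Q c) (s : SD Q c) (σ : X.E →ₗ[MvPolynomial (Fin c) Q] X.E) (u) :
    X.stepσ s σ (GC.inl s u) = GC.inl s (σ u) :=
  Prod.ext rfl (by change -σ 0 = 0; simp)
theorem GC.stepσ_inr (X : GC Q c) (s : SD Q c) (σ : X.E →ₗ[MvPolynomial (Fin c) Q] X.E) (u) :
    X.stepσ s σ (GC.inr s u) = - GC.inr s (σ u) :=
  Prod.ext (by change σ 0 = -0; simp) rfl
theorem GC.newσ_inl (X : GC Q c) (s : SD Q c) (u) :
    X.newσ s (GC.inl s u) = GC.inr s u := rfl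
theorem GC.newσ_inr (X : GC Q c) (s : SD Q c) (u) :
    X.newσ s (GC.inr s u) = 0 := rfl

theorem GC.lin_smul (X : GC Q c) (σ : X.E →ₗ[MvPolynomial (Fin c) Q] X.E) (a : Q) (y : X.E) :
    σ (a • y) = a • σ y := (σ.restrictScalars Q).map_smul a y

theorem GC.stepσ_eq (X : GC Q c) (s : SD Q c) (σ : X.E →ₗ[MvPolynomial (Fin c) Q] X.E)
    (b : MvPolynomial (Fin c) Q)
    (h : ∀ x, X.δ (σ x) + σ (X.δ x) = b • x) (x) :
    (X.step s).δ (X.stepσ s σ x) + X.stepσ s σ ((X.step s).δ x) = b • x := by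
  obtain ⟨u, v, rfl⟩ : ∃ u v, x = GC.inl s u + GC.inr s v := ⟨_, _, GC.eq_inl_add_inr s x⟩
  simp only [map_add, map_sub, map_neg, GC.stepσ_inl, GC.stepσ_inr, GC.δ_inl, GC.δ_inr, smul_add,
    GC.smul_inl, GC.smul_inr, ← h, GC.lin_smul, map_smul, smul_neg]
  abel

theorem GC.newσ_eq (X : GC Q c) (s : SD Q c) (x) :
    (X.step s).δ (X.newσ s x) + X.newσ s ((X.step s).δ x) = s.b • x := by
  obtain ⟨u, v, rfl⟩ : ∃ u v, x = GC.inl s u + GC.inr s v := ⟨_, _, GC.eq_inl_add_inr s x⟩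
  simp only [map_add, map_sub, GC.newσ_inl, GC.newσ_inr, GC.δ_inl, GC.δ_inr, smul_add,
    GC.smul_inl, GC.smul_inr, GC.lin_smul, map_zero, smul_zero]
  abel

theorem GC.inl_inr_zero (X : GC Q c) (s : SD Q c) (u v : X.E) :
    GC.inl s u + GC.inr s v = 0 ↔ u = 0 ∧ v = 0 := by
  constructor
  · intro h
    have h1 := congrArg (GC.cop s LinearMap.id 0) h
    have h2 := congrArg (GC.cop s 0 LinearMap.id) h
    simp only [map_add, GC.cop_inl, GC.cop_inr, map_zero] at h1 h2
    exact ⟨by simpa using h1, by simpa using h2⟩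
  · rintro ⟨rfl, rfl⟩; simp

theorem GC.Null.step {X : GC Q c} {b} (h : X.Null b) (s : SD Q c) : (X.step s).Null b := by
  obtain ⟨σ, h⟩ := h
  exact ⟨X.stepσ s σ, X.stepσ_eq s σ b h⟩

theorem GC.NullF.step {X : GC Q c} {b} (h : X.NullF b) (s : SD Q c) : (X.step s).NullF b := by
  obtain ⟨σ, h, h2⟩ := h
  refine ⟨X.stepσ s σ, X.stepσ_eq s σ b h, fun n x hx i hi => ?_⟩
  obtain ⟨u, v, rfl⟩ : ∃ u v, x = GC.inl s u + GC.inr s v := ⟨_, _, GC.eq_inl_add_inr s x⟩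
  simp only [map_add, GC.π_inl, GC.π_inr, GC.inl_inr_zero] at hx
  rw [map_add, GC.stepσ_inl, GC.stepσ_inr, ← map_neg, map_add, GC.π_inl, GC.π_inr, GC.inl_inr_zero]
  refine ⟨h2 n _ (fun j hj => (hx j hj).1) i hi, ?_⟩
  rw [map_neg, neg_eq_zero]
  refine h2 (n - s.w) _ (fun j hj => ?_) _ (by omega)
  have := (hx (j + s.w) (by omega)).2
  rwa [add_sub_cancel_right] at this

theorem GC.Null.new (X : GC Q c) (s : SD Q c) : (X.step s).Null s.b := ⟨X.newσ s, X.newσ_eq s⟩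

theorem GC.NullF.new (X : GC Q c) (s : SD Q c) (hs : 1 ≤ s.m) : (X.step s).NullF s.b := by
  refine ⟨X.newσ s, X.newσ_eq s, fun n x hx i hi => ?_⟩
  obtain ⟨u, v, rfl⟩ : ∃ u v, x = GC.inl s u + GC.inr s v := ⟨_, _, GC.eq_inl_add_inr s x⟩
  simp only [map_add, GC.π_inl, GC.π_inr, GC.inl_inr_zero] at hx
  rw [map_add, GC.newσ_inl, GC.newσ_inr, add_zero, GC.π_inr,
    (hx (i - s.w) (by simp only [SD.w]; omega)).1, map_zero]

theorem GC.Null.steps {X : GC Q c} {b} (h : X.Null b) (l : List (SD Q c)) : (X.steps l).Null b := by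
  induction l with
  | nil => exact h
  | cons s l ih => exact ih.step s

theorem GC.Null.steps_new (X : GC Q c) (l : List (SD Q c)) : ∀ s ∈ l, (X.steps l).Null s.b := by
  induction l with
  | nil => simp
  | cons s l ih =>
    intro s' hs'
    rcases List.mem_cons.1 hs' with rfl | h
    · exact GC.Null.new _ _
    · exact (ih s' h).step s

theorem GC.NullF.steps_new (X : GC Q c) (l : List (SD Q c)) (hl : ∀ s ∈ l, 1 ≤ s.m) :
    ∀ s ∈ l, (X.steps l).NullF s.b := by
  induction l with
  | nil => simp
  | cons s l ih =>
    intro s' hs'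
    rcases List.mem_cons.1 hs' with rfl | h
    · exact GC.NullF.new _ _ (hl _ List.mem_cons_self)
    · exact (ih (fun r hr => hl r (List.mem_cons_of_mem _ hr)) s' h).step s

theorem GC.NullF.trunc [IsNoetherianRing Q] {X : GC Q c} {b} (h : X.NullF b) (n : ℤ) : (X.trunc n).Null b := by
  obtain ⟨σ, h, h2⟩ := h
  refine ⟨σ.restrict (p := X.truncS n) (q := X.truncS n) (h2 n), fun x => Subtype.ext (h x.1)⟩

section dirA
variable (X : GC Q c)

def GC.nS : Submodule (MvPolynomial (Fin c) Q) X.E where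
  carrier := nE Q X.E
  add_mem' := add_mem
  zero_mem' := zero_mem _
  smul_mem' b _ hx := nE_map (X.sQ b) hx

noncomputable def GC.Zc : Submodule (MvPolynomial (Fin c) Q) X.E := X.nS.comap X.δ
noncomputable def GC.Bc : Submodule (MvPolynomial (Fin c) Q) X.E := LinearMap.range X.δ ⊔ X.nS

def GC.bI : Ideal (MvPolynomial (Fin c) Q) where
  carrier := {q | ∀ z ∈ X.Zc, q • z ∈ X.Bc}
  add_mem' h1 h2 z hz := by rw [add_smul]; exact add_mem (h1 z hz) (h2 z hz)
  zero_mem' z _ := by rw [zero_smul]; exact zero_mem _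
  smul_mem' a q h z hz := by rw [smul_assoc]; exact Submodule.smul_mem _ _ (h z hz)

theorem GC.Null.mem_bI {X : GC Q c} {b} (h : X.Null b) : b ∈ X.bI := by
  obtain ⟨σ, h⟩ := h
  intro z hz
  rw [← h]
  exact Submodule.add_mem_sup ⟨_, rfl⟩ (nE_map (σ.restrictScalars Q) hz)

theorem GC.C_mem_bI (q : Q) (hq : q ∈ maximalIdeal Q) : C q ∈ X.bI := by
  intro z _
  rw [X.CC_smul]
  exact Submodule.mem_sup_right (smul_mem_nE hq z)

theorem GC.dirA [IsNoetherianRing Q] (D : ℕ)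
    (hD : ∀ (d : Fin c →₀ ℕ) (a : Q), D ≤ d.degree → monomial d a ∈ X.bI) :
    ∃ B : ℤ, ∀ i, B ≤ i → ∀ z, X.π i z = z → X.δ z ∈ nE Q X.E → ∃ y, z - X.δ y ∈ nE Q X.E := by
  have hN : IsNoetherian (MvPolynomial (Fin c) Q) X.E := inferInstance
  obtain ⟨G, hG⟩ := hN.noetherian X.Zc
  have hGm : ∀ g ∈ G, g ∈ X.Zc := fun g hg => hG ▸ Submodule.subset_span hg
  choose bd hbd using X.π_fin
  obtain ⟨B0, hB0⟩ := (G.image bd).bddAbove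
  have hB : ∀ g ∈ G, ∀ i, B0 ≤ i → X.π i g = 0 := fun g hg i hi =>
    hbd g i ((hB0 (Finset.mem_coe.2 (Finset.mem_image_of_mem _ hg))).trans hi)
  let B := B0 + 2 * D
  let P : X.E → Prop := fun z => ∃ w, (∀ i, B ≤ i → X.π i w = 0) ∧ z - w ∈ X.Bc
  have P0 : P 0 := ⟨0, by simp, by simp⟩
  have Padd : ∀ x y, P x → P y → P (x + y) := by
    rintro x y ⟨w, h1, h2⟩ ⟨v, h3, h4⟩
    refine ⟨w + v, fun i hi => by rw [map_add, h1 i hi, h3 i hi, add_zero], ?_⟩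
    have := add_mem h2 h4
    convert this using 1; abel
  have Psum : ∀ {ι : Type} (s : Finset ι) (f : ι → X.E), (∀ i ∈ s, P (f i)) → P (∑ i ∈ s, f i) := by
    intro ι s f h
    exact Finset.sum_induction f P Padd P0 h
  have hP : ∀ z ∈ X.Zc, ∀ q : MvPolynomial (Fin c) Q, P (q • z) := by
    intro z hz
    rw [← hG] at hz
    refine Submodule.span_induction (p := fun z _ => ∀ q : MvPolynomial (Fin c) Q, P (q • z)) ?_ ?_ ?_ ?_ hz
    · intro g hg q
      rw [q.as_sum, Finset.sum_smul]
      refine Psum _ _ fun d _ => ?_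
      by_cases hd : D ≤ d.degree
      · refine ⟨0, by simp, ?_⟩
        rw [sub_zero]
        exact hD d _ hd g (hGm g hg)
      · refine ⟨monomial d (coeff d q) • g, fun i hi => ?_, by simp⟩
        have := X.π_monomial d (coeff d q) (i - 2 * (d.degree : ℕ)) g
        rw [sub_add_cancel] at this
        rw [this, hB g hg _ (by omega), smul_zero]
    · intro q; rw [smul_zero]; exact P0
    · intro x y _ _ hx hy q; rw [smul_add]; exact Padd _ _ (hx q) (hy q)
    · intro a x _ hx q; rw [smul_smul]; exact hx _
  refine ⟨B, fun i hi z hz hδ => ?_⟩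
  obtain ⟨w, h1, h2⟩ := hP z hδ 1
  rw [one_smul] at h2
  obtain ⟨_, ⟨y, rfl⟩, v, hv, e⟩ := Submodule.mem_sup.1 h2
  refine ⟨X.π (i-1) y, ?_⟩
  have h3 := congrArg (X.π i) e
  rw [map_sub, h1 i hi, sub_zero, hz, map_add] at h3
  have h4 := X.π_δ (i-1) y
  rw [sub_add_cancel] at h4
  rw [h4] at h3
  rw [← h3, add_sub_cancel_left]
  exact nE_map _ hv
end dirA
end HS
end HSpart7

section HSpart8
namespace HS
open MvPolynomial
variable {Q : Type} [CommRing Q] {c : ℕ}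
set_option linter.unusedSectionVars false

theorem GC.dualBasis (X : GC Q c) (hL : X.Lift ∅) (i : ℤ) :
    ∃ (r : ℕ) (e : Fin r → X.E) (l : Fin r → X.E →ₗ[Q] Q), (∀ j, X.π i (e j) = e j) ∧
      (∀ j x, l j (X.π i x) = l j x) ∧ ∀ x, X.π i x = ∑ j, l j x • e j := by
  haveI : Module.Finite Q (LinearMap.range (X.π i)) := Module.Finite.iff_fg.2 (X.fg i)
  obtain ⟨r, p, hp⟩ := Module.Finite.exists_fin' Q (LinearMap.range (X.π i))
  obtain ⟨ψ, h1, h2⟩ := hL _ _ p hp i (X.π i).rangeRestrict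
    ⟨fun x => Subtype.ext (X.π_idem i x), fun r hr => absurd hr (Set.notMem_empty r)⟩
  have he : ∀ j, X.π i (p (Pi.single j 1)).1 = (p (Pi.single j 1)).1 := fun j => by
    obtain ⟨y, hy⟩ := (p (Pi.single j 1)).2
    rw [← hy, X.π_idem]
  refine ⟨r, fun j => (p (Pi.single j 1)).1, fun j => LinearMap.proj j ∘ₗ ψ, he, fun j x => ?_, fun x => ?_⟩
  · simp [h1.1]
  · have := congrArg Subtype.val (h2 x)
    rw [show X.π i x = ((X.π i).rangeRestrict x).1 from rfl, ← this]
    conv_lhs => rw [pi_eq_sum_univ' (ψ x), map_sum]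
    rw [AddSubmonoidClass.coe_finsetSum]
    refine Finset.sum_congr rfl fun j _ => ?_
    rw [map_smul]; rfl

/-- degree-`i` functionals -/
def GC.Tm (X : GC Q c) (J : Ideal Q) (i : ℤ) : Submodule (Q ⧸ J) (X.E →ₗ[Q] Q ⧸ J) where
  carrier := {φ | ∀ x, φ (X.π i x) = φ x}
  add_mem' h h' x := by simp [h x, h' x]
  zero_mem' x := rfl
  smul_mem' a φ h x := by simp [h x]

theorem GC.Tm_TT {X : GC Q c} {J : Ideal Q} {i : ℤ} (φ : X.Tm J i) : X.TT ∅ i φ.1 :=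
  ⟨φ.2, fun r hr => absurd hr (Set.notMem_empty r)⟩

/-- the differential -/
noncomputable def GC.dT (X : GC Q c) (J : Ideal Q) (i j : ℤ) (h : i + 1 = j) : X.Tm J j →ₗ[Q ⧸ J] X.Tm J i where
  toFun φ := ⟨φ.1 ∘ₗ X.dQ, by subst h; exact (GC.Tm_TT φ).D.1⟩
  map_add' _ _ := rfl
  map_smul' _ _ := rfl

theorem GC.dT_apply (X : GC Q c) (J : Ideal Q) (i j : ℤ) (h : i + 1 = j) (φ : X.Tm J j) (x : X.E) :
    (X.dT J i j h φ).1 x = φ.1 (X.δ x) := rfl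

/-- functional in terms of the dual basis -/
noncomputable def lam (J : Ideal Q) {X : GC Q c} {i : ℤ} {l : X.E →ₗ[Q] Q} (h : ∀ x, l (X.π i x) = l x) : X.Tm J i :=
  ⟨Submodule.mkQ J ∘ₗ l, fun x => by simp [h]⟩

theorem lam_apply (J : Ideal Q) {X : GC Q c} {i : ℤ} {l : X.E →ₗ[Q] Q} (h : ∀ x, l (X.π i x) = l x) (x) :
    (lam J h).1 x = Ideal.Quotient.mk J (l x) := rfl

theorem Tm_expand (J : Ideal Q) {X : GC Q c} {i : ℤ} {r : ℕ} {e : Fin r → X.E} {l : Fin r → X.E →ₗ[Q] Q}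
    (h2 : ∀ j x, l j (X.π i x) = l j x) (h3 : ∀ x, X.π i x = ∑ j, l j x • e j) (φ : X.Tm J i) :
    φ = ∑ j, φ.1 (e j) • lam J (h2 j) := by
  apply Subtype.ext
  ext x
  rw [AddSubmonoidClass.coe_finsetSum, LinearMap.sum_apply, ← φ.2, h3, map_sum]
  refine Finset.sum_congr rfl fun j _ => ?_
  rw [map_smul, Submodule.coe_smul, LinearMap.smul_apply, lam_apply, smul_eq_mul, mul_comm, Algebra.smul_def]
  rfl

noncomputable def Tm_s (J : Ideal Q) {X : GC Q c} (i : ℤ) {r : ℕ} (e : Fin r → X.E) :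
    X.Tm J i →ₗ[Q ⧸ J] (Fin r → Q ⧸ J) where
  toFun φ j := φ.1 (e j)
  map_add' _ _ := rfl
  map_smul' _ _ := rfl

theorem Tm_proj (J : Ideal Q) (X : GC Q c) (hL : X.Lift ∅) (i : ℤ) : Module.Projective (Q ⧸ J) (X.Tm J i) := by
  obtain ⟨r, e, l, h1, h2, h3⟩ := X.dualBasis hL i
  refine Module.Projective.of_split (Tm_s J i e) (Fintype.linearCombination (Q ⧸ J) fun j => lam J (h2 j)) ?_
  refine LinearMap.ext fun φ => ?_
  exact (Tm_expand J h2 h3 φ).symm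

theorem Tm_finite (J : Ideal Q) (X : GC Q c) (hL : X.Lift ∅) (i : ℤ) : Module.Finite (Q ⧸ J) (X.Tm J i) := by
  obtain ⟨r, e, l, h1, h2, h3⟩ := X.dualBasis hL i
  refine Module.Finite.of_surjective (Fintype.linearCombination (Q ⧸ J) fun j => lam J (h2 j)) fun φ => ⟨Tm_s J i e φ, ?_⟩
  exact (Tm_expand J h2 h3 φ).symm

section
variable [IsLocalRing Q] {J : Ideal Q} (hJ : J ≤ maximalIdeal Q)
  [mk : Module (Q ⧸ J) (Q ⧸ maximalIdeal Q)] [IsScalarTower Q (Q ⧸ J) (Q ⧸ maximalIdeal Q)]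

theorem smul_red (a b : Q ⧸ J) : a • red hJ b = red hJ (a * b) := by
  obtain ⟨a, rfl⟩ := Ideal.Quotient.mk_surjective a
  rw [show (Ideal.Quotient.mk J a : Q ⧸ J) = a • 1 by rw [Algebra.smul_def, mul_one]; rfl, smul_assoc, one_smul,
    smul_mul_assoc, one_mul, map_smul]

/-- evaluation at `z` -/
noncomputable def evz (X : GC Q c) (i : ℤ) (z : X.E) : X.Tm J i →ₗ[Q ⧸ J] Q ⧸ maximalIdeal Q where
  toFun φ := red hJ (φ.1 z)
  map_add' φ ψ := by simp
  map_smul' a φ := by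
    rw [RingHom.id_apply, smul_red]; rfl

theorem evz_apply (X : GC Q c) (i : ℤ) (z : X.E) (φ : X.Tm J i) : evz hJ X i z φ = red hJ (φ.1 z) := rfl

theorem N1 (X : GC Q c) (hL : X.Lift ∅) (i : ℤ) (Φ : X.Tm J i →ₗ[Q ⧸ J] Q ⧸ maximalIdeal Q) :
    ∃ z, X.π i z = z ∧ Φ = evz hJ X i z := by
  obtain ⟨r, e, l, h1, h2, h3⟩ := X.dualBasis hL i
  choose q hq using fun j => Ideal.Quotient.mk_surjective (Φ (lam J (h2 j)))
  refine ⟨∑ j, q j • e j, by simp [h1], LinearMap.ext fun φ => ?_⟩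
  conv_lhs => rw [Tm_expand J h2 h3 φ]
  rw [evz_apply, map_sum, map_sum, map_sum]
  refine Finset.sum_congr rfl fun j _ => ?_
  rw [map_smul, ← hq, ← red_mk hJ (q j), smul_red, map_smul, Algebra.smul_def, mul_comm]
  rfl

theorem N2 (X : GC Q c) (hL : X.Lift ∅) (i : ℤ) (z : X.E) (hz : X.π i z = z)
    (h : ∀ φ : X.Tm J i, red hJ (φ.1 z) = 0) : z ∈ nE Q X.E := by
  obtain ⟨r, e, l, h1, h2, h3⟩ := X.dualBasis hL i
  rw [← hz, h3]
  refine sum_mem fun j _ => smul_mem_nE ?_ _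
  have := h (lam J (h2 j))
  rw [lam_apply, red_mk, Ideal.Quotient.eq_zero_iff_mem] at this
  exact this

theorem N3 (X : GC Q c) (φ : X.E →ₗ[Q] Q ⧸ J) {z : X.E} (hz : z ∈ nE Q X.E) : red hJ (φ z) = 0 :=
  nE_kill (red hJ ∘ₗ φ) hz

theorem ext_crit (hJ : J ≤ maximalIdeal Q) (X : GC Q c) (hL : X.Lift ∅) (hF : ∀ d, coeff d X.F ∈ J) (n : ℤ)
    (hEx : ∀ i, n < i → X.Ex (Q ⧸ J) ∅ i) {M : Type} [AddCommGroup M] [Module (Q ⧸ J) M]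
    (aug : X.Tm J n →ₗ[Q ⧸ J] M) (haug : Function.Surjective aug)
    (had : ∀ x, aug (X.dT J n (n+1) rfl x) = 0)
    (hex0 : ∀ x, aug x = 0 → ∃ y, X.dT J n (n+1) rfl y = x) (j : ℕ) :
    Nontrivial (((Ext (Q ⧸ J) (ModuleCat (Q ⧸ J)) (j+1)).obj (Opposite.op (ModuleCat.of (Q ⧸ J) M))).obj
      (ModuleCat.of (Q ⧸ J) (Q ⧸ maximalIdeal Q))) ↔
    ∃ z, X.π (n + j + 1) z = z ∧ X.δ z ∈ nE Q X.E ∧ ¬ ∃ y, z - X.δ y ∈ nE Q X.E := by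
  have hn : n + ((0:ℕ):ℤ) = n := by simp
  haveI : ∀ i : ℕ, Module.Projective (Q ⧸ J) (X.Tm J (n + i)) := fun i => Tm_proj J X hL _
  have key := ext_iff (A := Q ⧸ J) (fun i : ℕ => X.Tm J (n + i))
    (fun i => X.dT J (n + i) (n + ((i+1 : ℕ) : ℤ)) (by push_cast; ring)) (M := M)
    (show X.Tm J (n + ((0:ℕ):ℤ)) →ₗ[Q ⧸ J] M from aug ∘ₗ
      (LinearEquiv.ofEq _ _ (by rw [hn]) : X.Tm J (n + ((0:ℕ):ℤ)) ≃ₗ[Q ⧸ J] X.Tm J n).toLinearMap)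
    (fun i φ => by
      apply Subtype.ext; ext x
      rw [GC.dT_apply, GC.dT_apply, X.δδ]
      exact kills_of_map J _ hF _ _)
    (by
      intro m
      obtain ⟨y, hy⟩ := haug m
      exact ⟨⟨y.1, by rw [hn]; exact y.2⟩, hy⟩)
    (by
      intro x
      exact had ⟨x.1, by have := x.2; simpa using this⟩)
    (by
      intro x hx
      obtain ⟨y, hy⟩ := hex0 ⟨x.1, by have := x.2; simpa using this⟩ hx
      have hy' := congrArg Subtype.val hy
      refine ⟨⟨y.1, ?_⟩, Subtype.ext ?_⟩
      · have := y.2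
        rw [show n + ((0+1:ℕ):ℤ) = n + 1 by simp]
        exact this
      · exact hy')
    (by
      intro i x hx
      obtain ⟨ψ, t, e⟩ := hEx (n + ((i+1:ℕ):ℤ)) (by push_cast; omega) x.1 (GC.Tm_TT x)
        (fun z => by
          have := congrArg (fun t => t.1 z) hx
          exact this)
      refine ⟨⟨ψ, ?_⟩, Subtype.ext (LinearMap.ext e)⟩
      have := t.1
      rw [show n + ((i+1+1 : ℕ):ℤ) = n + ((i+1:ℕ):ℤ) + 1 by push_cast; ring]
      exact this)
    (Q ⧸ maximalIdeal Q) j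
  rw [key]
  have hnj : n + ((j+1 : ℕ):ℤ) = n + j + 1 := by push_cast; ring
  have hnj2 : n + ((j+1+1 : ℕ):ℤ) = n + j + 1 + 1 := by push_cast; ring
  constructor
  · rintro ⟨Φ, h1, h2⟩
    obtain ⟨z, hz, rfl⟩ := N1 hJ X hL _ Φ
    rw [hnj] at hz
    refine ⟨z, hz, ?_, ?_⟩
    · refine N2 hJ X hL (n + ((j+1+1 : ℕ):ℤ)) _ ?_ fun φ => h1 φ
      rw [hnj2, X.π_δ, hz]
    · rintro ⟨y, hy⟩
      refine h2 ⟨evz hJ X _ y, fun φ => ?_⟩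
      have := N3 hJ X φ.1 hy
      rw [map_sub, map_sub, sub_eq_zero] at this
      exact this
  · rintro ⟨z, hz, h1, h2⟩
    refine ⟨evz hJ X _ z, fun φ => N3 hJ X φ.1 h1, ?_⟩
    rintro ⟨Ψ, hΨ⟩
    obtain ⟨y, hy, rfl⟩ := N1 hJ X hL _ Ψ
    refine h2 ⟨y, N2 hJ X hL (n + ((j+1 : ℕ):ℤ)) _ ?_ fun φ => ?_⟩
    · rw [hnj, map_sub, hz, X.π_δ, hy]
    · rw [map_sub, map_sub, sub_eq_zero]
      exact hΨ φ
end
end HS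
end HSpart8

section HSpart9
namespace HS
open MvPolynomial
variable {Q : Type} [CommRing Q] {c : ℕ}

theorem iota_π (X : GC Q c) (l : List (SD Q c)) (i : ℤ) (x : X.E) :
    (X.steps l).π i (X.iota l x) = X.iota l (X.π i x) := by
  induction l with
  | nil => rfl
  | cons s l ih =>
    change ((X.steps l).step s).π i (GC.inl s (X.iota l x)) = GC.inl s (X.iota l (X.π i x))
    rw [GC.π_inl, ih]

theorem iota_δ (X : GC Q c) {N : Type} [AddCommGroup N] [Module Q N] (l : List (SD Q c))
    (hl : ∀ s ∈ l, ∀ y : N, s.a • y = 0) (θ : (X.steps l).E →ₗ[Q] N) (x : X.E) :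
    θ ((X.steps l).δ (X.iota l x)) = θ (X.iota l (X.δ x)) := by
  induction l with
  | nil => rfl
  | cons s l ih =>
    change θ (((X.steps l).step s).δ (GC.inl s (X.iota l x))) = θ (GC.inl s (X.iota l (X.δ x)))
    refine (congrArg θ (GC.δ_inl s _)).trans ?_
    refine (θ.map_add (GC.inl s ((X.steps l).δ (X.iota l x))) (s.a • GC.inr s (X.iota l x))).trans ?_
    have h1 : θ (s.a • GC.inr s (X.iota l x)) = 0 := by
      exact (θ.map_smul s.a _).trans (hl s (by simp) _)
    rw [h1, add_zero]
    exact ih (fun s hs => hl s (List.mem_cons_of_mem _ hs)) (θ ∘ₗ GC.inl s)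

theorem iota_ext (X : GC Q c) {N : Type} [AddCommGroup N] [Module Q N] (l : List (SD Q c))
    (i : ℤ) (φ : X.E →ₗ[Q] N) (hφ : X.TT ∅ i φ) :
    ∃ ψ : (X.steps l).E →ₗ[Q] N, (X.steps l).TT ∅ i ψ ∧ ∀ x, ψ (X.iota l x) = φ x := by
  induction l with
  | nil => exact ⟨φ, hφ, fun _ => rfl⟩
  | cons s l ih =>
    obtain ⟨ψ, h1, h2⟩ := ih
    refine ⟨GC.cop s ψ 0, GC.TT_cop s h1 ⟨by simp, by simp⟩, fun x => ?_⟩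
    change GC.cop s ψ 0 (GC.inl s (X.iota l x)) = _
    rw [GC.cop_inl, h2]

section gen
variable (X : GC Q c) (N : Type) [AddCommGroup N] [Module Q N]
/-- degree `i` functionals, over `Q` -/
def GC.TQ (i : ℤ) : Submodule Q (X.E →ₗ[Q] N) where
  carrier := {φ | ∀ x, φ (X.π i x) = φ x}
  add_mem' h h' x := by simp [h x, h' x]
  zero_mem' x := rfl
  smul_mem' a φ h x := by simp [h x]

/-- boundaries -/
def GC.BQ (i : ℤ) : Submodule Q (X.TQ N i) where
  carrier := {φ | ∃ ψ : X.TQ N (i+1), ∀ x, ψ.1 (X.δ x) = φ.1 x}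
  add_mem' := by
    rintro φ φ' ⟨ψ, h⟩ ⟨ψ', h'⟩
    exact ⟨ψ + ψ', fun x => by
      change ψ.1 (X.δ x) + ψ'.1 (X.δ x) = φ.1 x + φ'.1 x
      rw [h, h']⟩
  zero_mem' := ⟨0, fun x => rfl⟩
  smul_mem' := by
    rintro a φ ⟨ψ, h⟩
    exact ⟨a • ψ, fun x => by
      change a • ψ.1 (X.δ x) = a • φ.1 x
      rw [h]⟩

/-- the module -/
def MM (n : ℤ) : Type := X.TQ N n ⧸ X.BQ N n

noncomputable instance (n : ℤ) : AddCommGroup (MM X N n) :=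
  inferInstanceAs (AddCommGroup (X.TQ N n ⧸ X.BQ N n))
noncomputable instance (n : ℤ) : Module Q (MM X N n) :=
  inferInstanceAs (Module Q (X.TQ N n ⧸ X.BQ N n))

/-- the class of a functional -/
noncomputable def mkM (n : ℤ) : X.TQ N n →ₗ[Q] MM X N n := (X.BQ N n).mkQ

theorem mkM_surj (n : ℤ) : Function.Surjective (mkM X N n) := Submodule.mkQ_surjective _

theorem mkM_zero (n : ℤ) (φ : X.TQ N n) :
    mkM X N n φ = 0 ↔ ∃ ψ : X.TQ N (n+1), ∀ x, ψ.1 (X.δ x) = φ.1 x :=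
  Submodule.Quotient.mk_eq_zero _

theorem MM_tors (I : Ideal Q) (hN : ∀ a ∈ I, ∀ y : N, a • y = 0) (n : ℤ) :
    Module.IsTorsionBySet Q (MM X N n) (I : Set Q) := by
  intro x a
  obtain ⟨φ, rfl⟩ := mkM_surj X N n x
  have : (a : Q) • φ = 0 := by
    apply Subtype.ext
    ext x
    exact hN a.1 a.2 _
  have h2 : (a : Q) • mkM X N n φ = 0 := by rw [← map_smul, this, map_zero]
  exact h2

theorem TQ_finite (hL : X.Lift ∅) [Module.Finite Q N] (n : ℤ) : Module.Finite Q (X.TQ N n) := by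
  obtain ⟨r, e, l, h1, h2, h3⟩ := X.dualBasis hL n
  let T : (Fin r → N) →ₗ[Q] X.TQ N n :=
    { toFun := fun v => ⟨∑ j, (l j).smulRight (v j), fun x => by simp [h2]⟩
      map_add' := fun v w => by apply Subtype.ext; ext x; simp [Finset.sum_add_distrib]
      map_smul' := fun a v => by
        apply Subtype.ext; ext x
        simp [Finset.smul_sum, smul_comm a] }
  refine Module.Finite.of_surjective T fun φ => ⟨fun j => φ.1 (e j), ?_⟩
  apply Subtype.ext
  ext x
  rw [← φ.2, h3, map_sum]
  change (∑ j, (l j).smulRight (φ.1 (e j))) x = _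
  simp

theorem MM_fin (hL : X.Lift ∅) [Module.Finite Q N] (n : ℤ) : Module.Finite Q (MM X N n) := by
  have := TQ_finite X N hL n
  exact Module.Finite.of_surjective (mkM X N n) (mkM_surj X N n)

end gen

theorem steps_low (X : GC Q c) (l : List (SD Q c)) (hm : ∀ s ∈ l, s.m = 1) (n : ℤ)
    (h : ∀ i, i < n → ∀ x, X.π i x = 0) : ∀ i, i < n → ∀ x, (X.steps l).π i x = 0 := by
  induction l with
  | nil => exact h
  | cons s l ih =>
    intro i hi x
    have ih' := ih fun s hs => hm s (List.mem_cons_of_mem _ hs)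
    have hs := hm s (by simp)
    change ((X.steps l).step s).E at x
    change ((X.steps l).step s).π i x = 0
    obtain ⟨u, v, hx⟩ : ∃ u v : (X.steps l).E, x = GC.inl s u + GC.inr s v := ⟨_, _, GC.eq_inl_add_inr s x⟩
    rw [hx]
    rw [map_add, GC.π_inl, GC.π_inr, ih' i hi, ih' _ (by rw [SD.w, hs]; push_cast; omega), map_zero, map_zero, add_zero]

section
variable {X : GC Q c} {I : Ideal Q} {n : ℤ} {J : Ideal Q} (hJI : J ≤ I) (l : List (SD Q c))

/-- restriction along `iota` and reduction -/
noncomputable def rI (i : ℤ) (φ : (X.steps l).Tm J i) : X.TQ (Q ⧸ I) i :=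
  ⟨red hJI ∘ₗ φ.1 ∘ₗ X.iota l, fun x => by
    simp only [LinearMap.comp_apply]
    rw [← iota_π, φ.2]⟩

theorem rI_apply (i : ℤ) (φ : (X.steps l).Tm J i) (x) : (rI hJI l i φ).1 x = red hJI (φ.1 (X.iota l x)) := rfl

theorem rI_add (i : ℤ) (φ ψ : (X.steps l).Tm J i) : rI hJI l i (φ + ψ) = rI hJI l i φ + rI hJI l i ψ := by
  apply Subtype.ext; ext x
  exact (red hJI).map_add _ _

theorem rI_smul (i : ℤ) (q : Q) (φ : (X.steps l).Tm J i) :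
    rI hJI l i ((Ideal.Quotient.mk J q) • φ) = q • rI hJI l i φ := by
  apply Subtype.ext; ext x
  change red hJI (Ideal.Quotient.mk J q * φ.1 (X.iota l x)) = q • red hJI (φ.1 (X.iota l x))
  rw [← map_smul, Algebra.smul_def]; rfl

variable [mA : Module (Q ⧸ J) (MM X (Q ⧸ I) n)] [IsScalarTower Q (Q ⧸ J) (MM X (Q ⧸ I) n)]

noncomputable def augM : (X.steps l).Tm J n →ₗ[Q ⧸ J] MM X (Q ⧸ I) n where
  toFun φ := mkM X (Q ⧸ I) n (rI hJI l n φ)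
  map_add' φ ψ := by rw [rI_add, map_add]
  map_smul' a φ := by
    obtain ⟨a, rfl⟩ := Ideal.Quotient.mk_surjective a
    rw [rI_smul, RingHom.id_apply, show (Ideal.Quotient.mk J a : Q ⧸ J) = a • 1 by rw [Algebra.smul_def, mul_one]; rfl,
      smul_assoc, one_smul, map_smul]

theorem augM_eq_zero (φ : (X.steps l).Tm J n) : augM (n := n) hJI l φ = 0 ↔
    ∃ ψ : X.TQ (Q ⧸ I) (n+1), ∀ x, ψ.1 (X.δ x) = red hJI (φ.1 (X.iota l x)) := by
  change mkM X (Q ⧸ I) n (rI hJI l n φ) = 0 ↔ _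
  rw [mkM_zero]
  rfl

variable [IsLocalRing Q]
  [mk : Module (Q ⧸ J) (Q ⧸ maximalIdeal Q)] [IsScalarTower Q (Q ⧸ J) (Q ⧸ maximalIdeal Q)]

theorem main_crit (hJI : J ≤ I) (hJ : J ≤ maximalIdeal Q) (hL : X.Lift ∅) (hEx : ∀ i, n < i → X.Ex (Q ⧸ I) ∅ i)
    (hm : ∀ s ∈ l, s.m = 1) (hR : RegOn J (l.map SD.a)) (hF : ∀ d, coeff d (X.steps l).F ∈ J)
    (hK : I = JJ J (l.map SD.a)) (hla : ∀ s ∈ l, s.a ∈ I) (hX0 : ∀ i, i < n → ∀ x, X.π i x = 0) (j : ℕ) :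
    Nontrivial (((Ext (Q ⧸ J) (ModuleCat (Q ⧸ J)) (j+1)).obj (Opposite.op (ModuleCat.of (Q ⧸ J) (MM X (Q ⧸ I) n)))).obj
      (ModuleCat.of (Q ⧸ J) (Q ⧸ maximalIdeal Q))) ↔
    ∃ z, (X.steps l).π (n + j + 1) z = z ∧ (X.steps l).δ z ∈ nE Q (X.steps l).E ∧
      ¬ ∃ y, z - (X.steps l).δ y ∈ nE Q (X.steps l).E := by
  have hkill : ∀ s ∈ l, ∀ y : Q ⧸ I, s.a • y = 0 := fun s hs y => smul_eq_zero_of_mem (hla s hs) y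
  refine ext_crit hJ (X.steps l) (GC.steps_Lift hL l) hF n ?_ (augM hJI l) ?_ ?_ ?_ j
  · intro i hi φ hφ hc
    refine Hrho X hL l hm J hR hF I hK hJI i φ hφ hc ?_
    refine hEx i hi (red hJI ∘ₗ φ ∘ₗ X.iota l) ⟨fun x => ?_, by simp⟩ fun x => ?_
    · simp only [LinearMap.comp_apply]
      rw [← iota_π, hφ.1]
    · have := iota_δ X l hkill (red hJI ∘ₗ φ) x
      simp only [LinearMap.comp_apply] at this ⊢
      rw [← this, hc, map_zero]
  · intro m
    obtain ⟨φ, rfl⟩ := mkM_surj X _ n m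
    obtain ⟨ψ, h1, h2⟩ := iota_ext X l n φ.1 ⟨φ.2, by simp⟩
    obtain ⟨χ, h3, h4⟩ := GC.steps_Lift hL l _ _ (red hJI) (red_surj hJI) n ψ h1
    refine ⟨⟨χ, h3.1⟩, ?_⟩
    refine congrArg (mkM X (Q ⧸ I) n) ?_
    apply Subtype.ext; ext x
    rw [rI_apply, h4, h2]
  · intro φ
    rw [augM_eq_zero]
    refine ⟨rI hJI l _ φ, fun x => ?_⟩
    rw [rI_apply, GC.dT_apply]
    exact (iota_δ X l hkill (red hJI ∘ₗ φ.1) x).symm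
  · intro φ hφ
    rw [augM_eq_zero] at hφ
    obtain ⟨ψ, hψ⟩ := hφ
    obtain ⟨χ, h1, h2⟩ := Hrho X hL l hm J hR hF I hK hJI n φ.1 (GC.Tm_TT φ) (fun x => by
      have h0 : (X.steps l).π n ((X.steps l).δ x) = 0 := by
        rw [show n = n - 1 + 1 by ring, (X.steps l).π_δ, steps_low X l hm n hX0 _ (by omega), map_zero]
      rw [← φ.2, h0, map_zero])
      ⟨ψ.1, ⟨ψ.2, by simp⟩, hψ⟩
    exact ⟨⟨χ, h1.1⟩, Subtype.ext (LinearMap.ext h2)⟩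
end
end HS
end HSpart9

section HSpart10
namespace HS
open MvPolynomial RingTheory.Sequence
variable {Q : Type} [CommRing Q] {c : ℕ}

/-- linear form with given coefficients -/
noncomputable def lin (v : Fin c → Q) : MvPolynomial (Fin c) Q := ∑ i, C (v i) * X i

theorem lin_hom (v : Fin c → Q) : (lin v).IsHomogeneous 1 :=
  IsHomogeneous.sum _ _ _ fun i _ => by
    simpa using (isHomogeneous_C (Fin c) (v i)).mul (isHomogeneous_X Q i)

theorem lin_eval (v a : Fin c → Q) : eval a (lin v) = ∑ i, v i * a i := by simp [lin]

theorem lin_coeff (v : Fin c → Q) (J : Ideal Q) (h : ∀ i, v i ∈ J) (d) : coeff d (lin v) ∈ J := by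
  rw [lin, coeff_sum]
  exact sum_mem fun i _ => by
    rw [coeff_C_mul]; exact Ideal.mul_mem_right _ _ (h i)

/-- linear steps -/
noncomputable def lsteps {e : ℕ} (x : Fin e → Q) (v : Fin e → Fin c → Q) : List (SD Q c) :=
  List.ofFn fun j => ⟨x j, lin (v j), 1, lin_hom _, Or.inr rfl⟩

theorem lsteps_a {e : ℕ} (x : Fin e → Q) (v : Fin e → Fin c → Q) :
    (lsteps x v).map SD.a = List.ofFn x := by
  rw [lsteps, List.map_ofFn]; rfl

theorem lsteps_mem {e : ℕ} {x : Fin e → Q} {v : Fin e → Fin c → Q} {s} (hs : s ∈ lsteps x v) :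
    ∃ j, s.a = x j ∧ s.b = lin (v j) ∧ s.m = 1 := by
  rw [lsteps, List.mem_ofFn] at hs
  obtain ⟨j, rfl⟩ := hs
  exact ⟨j, rfl, rfl, rfl⟩

theorem mem_lsteps {e : ℕ} (x : Fin e → Q) (v : Fin e → Fin c → Q) (j) :
    ∃ s ∈ lsteps x v, s.b = lin (v j) :=
  ⟨_, List.mem_ofFn.2 ⟨j, rfl⟩, rfl⟩

theorem lsteps_F {e : ℕ} (x : Fin e → Q) (v : Fin e → Fin c → Q) :
    ((lsteps x v).map fun s => C s.a * s.b).sum = lin fun i => ∑ j, x j * v j i := by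
  rw [lsteps, List.map_ofFn, List.sum_ofFn]
  simp only [Function.comp_apply, lin, Finset.mul_sum, map_sum, Finset.sum_mul]
  rw [Finset.sum_comm]
  refine Finset.sum_congr rfl fun i _ => Finset.sum_congr rfl fun j _ => ?_
  rw [C_mul, mul_assoc]

variable [IsLocalRing Q] [IsNoetherianRing Q]

theorem C0_exists (rs : List Q) (hrs : IsWeaklyRegular Q rs) (hspan : Ideal.span {x | x ∈ rs} = maximalIdeal Q)
    (f : Fin c → Q) (hf : IsWeaklyRegular Q (List.ofFn f)) (I : Ideal Q) (hIf : I = Ideal.span (Set.range f))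
    (hIsq : I ≤ maximalIdeal Q ^ 2)
    (𝔞 : Ideal (MvPolynomial (Fin c) (Q ⧸ maximalIdeal Q)))
    (h𝔞 : ∀ p ∈ 𝔞, ∀ n : ℕ, homogeneousComponent n p ∈ 𝔞) :
    ∃ (X : GC Q c) (n : ℤ), X.Lift ∅ ∧ (∀ i, n < i → X.Ex (Q ⧸ I) ∅ i) ∧ X.F = lin f ∧
      (∀ i, i < n → ∀ x, X.π i x = 0) ∧
      (∀ a : Fin c → Q, (¬ ∀ i, a i ∈ maximalIdeal Q) →
        (∀ p ∈ 𝔞, eval (fun i => Ideal.Quotient.mk (maximalIdeal Q) (a i)) p = 0) → X.PtB a) ∧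
      (∀ a : Fin c → Q, (¬ ∀ i, a i ∈ maximalIdeal Q) → (∀ b, X.Null b → eval a b ∈ maximalIdeal Q) →
        ∀ p ∈ 𝔞, eval (fun i => Ideal.Quotient.mk (maximalIdeal Q) (a i)) p = 0) := by
  obtain ⟨L, hL1, hL2⟩ := gens 𝔞 h𝔞
  let x : Fin rs.length → Q := rs.get
  have hx : Ideal.span (Set.range x) = maximalIdeal Q := by
    rw [← hspan]; congr 1; ext y
    simp [x, List.mem_iff_get]
  have hxm : ∀ j, x j ∈ maximalIdeal Q := fun j => by
    rw [← hx]; exact Ideal.subset_span ⟨j, rfl⟩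
  have hfa : ∀ i, ∃ a : Fin rs.length → Q, (∀ j, a j ∈ maximalIdeal Q) ∧ f i = ∑ j, x j * a j := by
    intro i
    have h1 : f i ∈ maximalIdeal Q • Submodule.span Q (Set.range x) := by
      have h2 : f i ∈ maximalIdeal Q ^ 2 := hIsq (by rw [hIf]; exact Ideal.subset_span ⟨i, rfl⟩)
      rw [pow_two] at h2
      change f i ∈ maximalIdeal Q * Ideal.span (Set.range x)
      rwa [hx]
    rw [Submodule.mem_ideal_smul_span_iff_exists_sum] at h1
    obtain ⟨a, ha, e⟩ := h1
    refine ⟨a, ha, ?_⟩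
    rw [← e, Finsupp.sum_fintype _ _ (by simp)]
    exact Finset.sum_congr rfl fun j _ => mul_comm _ _
  choose a ha hfx using hfa
  let xs : List (SD Q c) := lsteps x fun j i => a i j
  let X1 := (base Q c).steps xs
  have hX1F : X1.F = lin f := by
    rw [GC.steps_F, show (base Q c).F = 0 from rfl, zero_add, lsteps_F]
    congr 1; funext i; exact (hfx i).symm
  have hxsm : ∀ s ∈ xs, s.m = 1 := fun s hs => by
    obtain ⟨j, _, _, h⟩ := lsteps_mem hs; exact h
  have hEx1 : ∀ i, 0 < i → X1.Ex (Q ⧸ I) ∅ i := by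
    intro i hi
    have h0 : X1.Ex (Q ⧸ Jt f 0) Set.univ i := by
      refine koszul_Ex xs hxsm _ ?_ i hi
      rw [lsteps_a, Jt_zero, show List.ofFn x = rs from List.ofFn_get rs]
      have := (wr_iff rs []).1 hrs
      rw [Ideal.ofList_nil] at this
      exact this.2
    have := chainX X1 (fun Θ => GC.steps_Lift (base_Lift Θ) xs)
      (fun Θ t ht => GC.steps_Surj (base_Surj Θ t ht) xs) f hX1F (hreg_of f hf) i h0 c le_rfl
    rw [Jt_top, ← hIf] at this
    convert this
    ext r; simp
  obtain ⟨n, hn⟩ := steps_Ex0 X1 (Q ⧸ I) 0 hEx1 L fun s hs => ⟨(hL1 s hs).1, (hL1 s hs).2.1⟩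
  refine ⟨(X1.steps L).trunc n, n, GC.trunc_Lift (GC.steps_Lift (GC.steps_Lift (base_Lift ∅) xs) L),
    fun i hi => GC.trunc_Ex i hi (hn i hi), ?_, fun i hi x => GC.trunc_π_low i hi x, ?_, ?_⟩
  · change (X1.steps L).F = _
    rw [GC.steps_F, hX1F]
    rw [List.sum_eq_zero, add_zero]
    intro y hy
    rw [List.mem_map] at hy
    obtain ⟨s, hs, rfl⟩ := hy
    rw [(hL1 s hs).1, C_0, zero_mul]
  · intro t ht hp
    refine GC.PtB.trunc (GC.PtB.steps (GC.PtB.steps (base_PtB t ht) xs ?_) L ?_) n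
    · intro s hs
      obtain ⟨j, h1, h2, _⟩ := lsteps_mem hs
      rw [h1, h2, lin_eval]
      exact ⟨hxm j, sum_mem fun i _ => Ideal.mul_mem_right _ _ (ha i j)⟩
    · intro s hs
      refine ⟨by rw [(hL1 s hs).1]; exact zero_mem _, ?_⟩
      rw [← Ideal.Quotient.eq_zero_iff_mem, mk_eval]
      exact hp _ (hL1 s hs).2.2
  · intro t ht hN
    refine hL2 t ht fun s hs => hN _ ?_
    exact (GC.NullF.steps_new X1 L (fun s hs => (hL1 s hs).2.1) s hs).trunc n

theorem final_crit [IsAlgClosed (ResidueField Q)]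
    (f : Fin c → Q) (hf : IsWeaklyRegular Q (List.ofFn f)) (I : Ideal Q) (hIf : I = Ideal.span (Set.range f))
    (hIm : I ≤ maximalIdeal Q)
    (P : (Fin c → Q) → Prop) (X : GC Q c) (n : ℤ) (hL : X.Lift ∅) (hEx : ∀ i, n < i → X.Ex (Q ⧸ I) ∅ i)
    (hF : X.F = lin f) (hlow : ∀ i, i < n → ∀ x, X.π i x = 0)
    (hP1 : ∀ a : Fin c → Q, (¬ ∀ i, a i ∈ maximalIdeal Q) → P a → X.PtB a)
    (hP2 : ∀ a : Fin c → Q, (¬ ∀ i, a i ∈ maximalIdeal Q) →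
      (∀ b, X.Null b → eval a b ∈ maximalIdeal Q) → P a)
    {d : ℕ} (g : Fin d → Q) (hgI : ∀ i, g i ∈ I)
    (hg : ∀ a : Fin d → Q, (∑ i, a i * g i) ∈ maximalIdeal Q * I → ∀ i, a i ∈ maximalIdeal Q)
    (J : Ideal Q) (hJ : J = Ideal.span (Set.range g)) (hJI : J ≤ I)
    [Module (Q ⧸ J) (MM X (Q ⧸ I) n)] [IsScalarTower Q (Q ⧸ J) (MM X (Q ⧸ I) n)]
    [Module (Q ⧸ J) (Q ⧸ maximalIdeal Q)] [IsScalarTower Q (Q ⧸ J) (Q ⧸ maximalIdeal Q)] :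
    (∀ N : ℕ, ∃ i, N ≤ i ∧ Nontrivial (((Ext (Q ⧸ J) (ModuleCat (Q ⧸ J)) i).obj
      (Opposite.op (ModuleCat.of (Q ⧸ J) (MM X (Q ⧸ I) n)))).obj
      (ModuleCat.of (Q ⧸ J) (Q ⧸ maximalIdeal Q)))) ↔
    ∃ a : Fin c → Q, (¬ ∀ i, a i ∈ maximalIdeal Q) ∧ P a ∧ (∑ i, a i * f i) ∈ J ⊔ maximalIdeal Q * I := by
  obtain ⟨e, h, hreg, hJJ, hsup, hind⟩ := exch_final I hIm f hf hIf g hgI hg J hJ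
  have hhI : ∀ l, h l ∈ I := fun l => by
    rw [← hsup]; exact Ideal.mem_sup_right (Ideal.subset_span ⟨l, rfl⟩)
  have hρ : ∀ i, ∃ ρ : Fin e → Q, f i - ∑ l, ρ l * h l ∈ J := by
    intro i
    have h1 : f i ∈ I := by rw [hIf]; exact Ideal.subset_span ⟨i, rfl⟩
    rw [← hsup, Submodule.mem_sup] at h1
    obtain ⟨y, hy, z, hz, e1⟩ := h1
    obtain ⟨ρ, rfl⟩ := span_coeffs h z hz
    exact ⟨ρ, by rw [← e1]; simpa using hy⟩
  choose ρ hρ using hρ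
  let hs : List (SD Q c) := lsteps h fun l i => -ρ i l
  have hm : ∀ s ∈ hs, s.m = 1 := fun s hs => by
    obtain ⟨j, _, _, h⟩ := lsteps_mem hs; exact h
  have hla : ∀ s ∈ hs, s.a ∈ I := fun s hs => by
    obtain ⟨j, h1, _, _⟩ := lsteps_mem hs; rw [h1]; exact hhI j
  have hFT : ∀ d, coeff d (X.steps hs).F ∈ J := by
    intro d
    have : (X.steps hs).F = lin fun i => f i - ∑ l, ρ i l * h l := by
      rw [GC.steps_F, hF, lsteps_F, lin, lin, lin, ← Finset.sum_add_distrib]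
      refine Finset.sum_congr rfl fun i _ => ?_
      rw [← add_mul, ← C_add]
      congr 2
      rw [sub_eq_add_neg, ← Finset.sum_neg_distrib]
      congr 1
      exact Finset.sum_congr rfl fun l _ => by ring
    rw [this]
    exact lin_coeff _ _ hρ d
  have crit := main_crit (X := X) (I := I) (n := n) (J := J) hs hJI (hJI.trans hIm) hL hEx hm
    (by rw [lsteps_a]; exact hreg) hFT (by rw [lsteps_a]; exact hJJ.symm) hla hlow
  have hsum : ∀ a : Fin c → Q, (∑ i, a i * f i) - ∑ l, (∑ i, ρ i l * a i) * h l ∈ J := by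
    intro a
    have : (∑ i, a i * f i) - ∑ l, (∑ i, ρ i l * a i) * h l = ∑ i, a i * (f i - ∑ l, ρ i l * h l) := by
      simp only [mul_sub, Finset.sum_sub_distrib, Finset.sum_mul, Finset.mul_sum]
      congr 1
      rw [Finset.sum_comm]
      exact Finset.sum_congr rfl fun i _ => Finset.sum_congr rfl fun l _ => by ring
    rw [this]
    exact sum_mem fun i _ => Ideal.mul_mem_left _ _ (hρ i)
  have hev : ∀ (a : Fin c → Q) l, eval a (lin fun i => -ρ i l) = - ∑ i, ρ i l * a i := by
    intro a l
    rw [lin_eval, ← Finset.sum_neg_distrib]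
    exact Finset.sum_congr rfl fun i _ => by ring
  constructor
  · intro hinf
    by_contra hno
    have hz : ∀ a : Fin c → Q, (∀ b ∈ (X.steps hs).bI, eval a b ∈ maximalIdeal Q) →
        ∀ i, a i ∈ maximalIdeal Q := by
      intro a hb
      by_contra hna
      refine hno ⟨a, hna, hP2 a hna fun b hbN => hb b (hbN.steps hs).mem_bI, ?_⟩
      rw [← sub_add_cancel (∑ i, a i * f i) (∑ l, (∑ i, ρ i l * a i) * h l)]
      refine add_mem (Ideal.mem_sup_left (hsum a)) (Ideal.mem_sup_right (sum_mem fun l _ => ?_))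
      refine Ideal.mul_mem_mul ?_ (hhI l)
      obtain ⟨s, hs1, hs2⟩ := mem_lsteps h (fun l i => -ρ i l) l
      have := hb _ (GC.Null.steps_new X hs s hs1).mem_bI
      rw [hs2, hev] at this
      simpa using this
    obtain ⟨D, hD⟩ := NS (X.steps hs).bI (fun q hq => (X.steps hs).C_mem_bI q hq) hz
    obtain ⟨B, hB⟩ := (X.steps hs).dirA D hD
    obtain ⟨i, hi, hnt⟩ := hinf ((B - n).toNat + 1)
    obtain ⟨j, rfl⟩ : ∃ j, i = j + 1 := ⟨i - 1, by omega⟩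
    obtain ⟨z, h1, h2, h3⟩ := (crit j).1 hnt
    exact h3 (hB (n + j + 1) (by omega) z h1 h2)
  · rintro ⟨a, ha, hPa, hsm⟩ N
    have hu : ∀ l, (∑ i, ρ i l * a i) ∈ maximalIdeal Q := by
      refine hind (fun l => ∑ i, ρ i l * a i) ?_
      have := sub_mem hsm (Ideal.mem_sup_left (hsum a) : _ ∈ J ⊔ maximalIdeal Q * I)
      rwa [sub_sub_cancel] at this
    have hpt : (X.steps hs).PtB a := by
      refine (hP1 a ha hPa).steps hs fun s hs => ?_
      refine ⟨hIm (hla s hs), ?_⟩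
      obtain ⟨l, _, h2, _⟩ := lsteps_mem hs
      rw [h2, hev]
      exact neg_mem (hu l)
    obtain ⟨i, hi, z, hz⟩ := hpt.final (n + N + 1)
    refine ⟨(i - n - 1).toNat + 1, by omega, (crit _).2 ⟨z, ?_⟩⟩
    rwa [show n + ((i - n - 1).toNat : ℤ) + 1 = i by omega]
end HS
end HSpart10

/-- Realizability for higher-order support varieties: for every closed cone
`Z = V(𝔞)` in `V` there is a module `M` whose `d`-th order support variety consists of the
`d`-planes meeting `Z` nontrivially. -/
theorem statement13
    (Q : Type) [CommRing Q] [IsLocalRing Q] [IsNoetherianRing Q]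
    (hQreg : IsRegularLocal Q)
    (c : ℕ) (hc : 1 ≤ c) (f : Fin c → Q)
    (hfreg : RingTheory.Sequence.IsRegular Q (List.ofFn f))
    (I : Ideal Q) (hIf : I = Ideal.span (Set.range f))
    (hIsq : I ≤ maximalIdeal Q ^ 2)
    [IsAlgClosed (ResidueField Q)]
    (d : ℕ) (hd1 : 1 ≤ d) (hdc : d ≤ c)
    (𝔞 : Ideal (MvPolynomial (Fin c) (Q ⧸ maximalIdeal Q)))
    (h𝔞 : ∀ p ∈ 𝔞, ∀ n : ℕ, MvPolynomial.homogeneousComponent n p ∈ 𝔞) :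
    ∃ (M : Type) (iM : AddCommGroup M), letI := iM; ∃ (mQM : Module Q M), letI := mQM;
      ∃ (_ : Module.Finite Q M) (hM : Module.IsTorsionBySet Q M (I : Set Q)),
      ∀ (g : Fin d → Q), RingTheory.Sequence.IsRegular Q (List.ofFn g) →
        LinIndepInV Q I g →
        ∀ (J : Ideal Q), J = Ideal.span (Set.range g) → ∀ (hJI : J ≤ I),
          (extInf (Q ⧸ J) M (Q ⧸ maximalIdeal Q) (modOver J hJI M hM)
              (kMod J (hJI.trans (hIsq.trans (Ideal.pow_le_self two_ne_zero)))) ↔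
            ∃ a : Fin c → Q, (¬ ∀ i, a i ∈ maximalIdeal Q) ∧
              (∀ p ∈ 𝔞, MvPolynomial.eval
                (fun i => Ideal.Quotient.mk (maximalIdeal Q) (a i)) p = 0) ∧
              (∑ i, a i * f i) ∈ J ⊔ maximalIdeal Q * I) := by
  obtain ⟨rs, hrs, hspan⟩ := hQreg
  have hIm : I ≤ maximalIdeal Q := hIsq.trans (Ideal.pow_le_self two_ne_zero)
  obtain ⟨X, n, hL, hEx, hF, hlow, hP1, hP2⟩ :=
    HS.C0_exists rs hrs.toIsWeaklyRegular hspan f hfreg.toIsWeaklyRegular I hIf hIsq 𝔞 h𝔞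
  have hfin : Module.Finite Q (Q ⧸ I) := inferInstance
  refine ⟨HS.MM X (Q ⧸ I) n, inferInstance, inferInstance, HS.MM_fin X (Q ⧸ I) hL n,
    HS.MM_tors X (Q ⧸ I) I (fun a ha y => HS.smul_eq_zero_of_mem ha y) n, ?_⟩
  intro g _ hg J hJ hJI
  have hM : Module.IsTorsionBySet Q (HS.MM X (Q ⧸ I) n) (I : Set Q) :=
    HS.MM_tors X (Q ⧸ I) I (fun a ha y => HS.smul_eq_zero_of_mem ha y) n
  letI m1 : Module (Q ⧸ J) (HS.MM X (Q ⧸ I) n) := modOver J hJI _ hM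
  haveI t1 : IsScalarTower Q (Q ⧸ J) (HS.MM X (Q ⧸ I) n) := (hM.mono' hJI).isScalarTower
  letI m2 : Module (Q ⧸ J) (Q ⧸ maximalIdeal Q) := kMod J (hJI.trans hIm)
  haveI t2 : IsScalarTower Q (Q ⧸ J) (Q ⧸ maximalIdeal Q) :=
    ((quot_isTorsionBySet Q (maximalIdeal Q)).mono' (hJI.trans hIm)).isScalarTower
  exact HS.final_crit f hfreg.toIsWeaklyRegular I hIf hIm
    (fun a => ∀ p ∈ 𝔞, MvPolynomial.eval (fun i => Ideal.Quotient.mk (maximalIdeal Q) (a i)) p = 0)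
    X n hL hEx hF hlow hP1 hP2 g hg.1 hg.2 J hJ hJI
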